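/- Define e(A) = E(A)/A with E(A) = inf{Per(Ω) + D(Ω) : |Ω| = A} for Ω ⊂ R^3. There exists A_* > 0 with e(A_*) = inf{e(A) : A > 0}, and the infimum defining E(A_*) is attained; that is, there is a set Ω_* of finite perimeter with (Per(Ω) + D(Ω))/|Ω| ≥ (Per(Ω_*) + D(Ω_*))/|Ω_*| for every set Ω ⊂ R^3 of finite perimeter with 0 < |Ω| < ∞. -/

import Mathlib

open MeasureTheory Filter Metric Set Topology

noncomputable section

/-- De Giorgi perimeter: the set of values `∫_E div F` over admissible vector fields. -/
def perSet (d : ℕ) (E : Set (EuclideanSpace ℝ (Fin d))) : Set ℝ :=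
  {p | ∃ F : EuclideanSpace ℝ (Fin d) → EuclideanSpace ℝ (Fin d),
      ContDiff ℝ 1 F ∧ HasCompactSupport F ∧ (∀ x, ‖F x‖ ≤ 1) ∧
      p = ∫ x in E, ∑ i, fderiv ℝ F x (EuclideanSpace.single i (1:ℝ)) i}

/-- De Giorgi perimeter of a measurable set. -/
def perimeter (d : ℕ) (E : Set (EuclideanSpace ℝ (Fin d))) : ℝ := sSup (perSet d E)

/-- A set has finite perimeter if the defining supremum is finite. -/
def FinitePerimeter (d : ℕ) (E : Set (EuclideanSpace ℝ (Fin d))) : Prop := BddAbove (perSet d E)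

/-- Riesz interaction energy. -/
def riesz (d : ℕ) (l : ℝ) (A : Set (EuclideanSpace ℝ (Fin d))) : ℝ :=
  (1/2) * ∫ x in A, ∫ y in A, ‖x - y‖ ^ (-l)

abbrev E3 := EuclideanSpace ℝ (Fin 3)

/-- Coulomb self-energy in dimension 3. -/
def coulomb (Ω : Set E3) : ℝ := (1/2) * ∫ x in Ω, ∫ y in Ω, ‖x - y‖⁻¹

/-- Liquid drop energy. -/
def ldEnergy (Ω : Set E3) : ℝ := perimeter 3 Ω + coulomb Ω

/-- Minimal liquid drop energy at mass `A`. -/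
def ldE (A : ℝ) : ℝ :=
  sInf {e | ∃ Ω : Set E3, MeasurableSet Ω ∧ FinitePerimeter 3 Ω ∧
      volume Ω = ENNReal.ofReal A ∧ e = ldEnergy Ω}


/-- Energy per particle of a set. -/
def ldRatio (Ω : Set E3) : ℝ := ldEnergy Ω / (volume Ω).toReal

open scoped ENNReal Pointwise

/-- The divergence of a vector field on Euclidean space. -/
def divg {d : ℕ} (F : EuclideanSpace ℝ (Fin d) → EuclideanSpace ℝ (Fin d))
    (x : EuclideanSpace ℝ (Fin d)) : ℝ :=
  ∑ i, fderiv ℝ F x (EuclideanSpace.single i (1:ℝ)) i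

/-- Test fields for the perimeter. -/
structure IsTestField {d : ℕ} (F : EuclideanSpace ℝ (Fin d) → EuclideanSpace ℝ (Fin d)) :
    Prop where
  contDiff : ContDiff ℝ 1 F
  hasCompactSupport : HasCompactSupport F
  norm_le_one : ∀ x, ‖F x‖ ≤ 1

section Divergence

variable {d : ℕ} {F G : EuclideanSpace ℝ (Fin d) → EuclideanSpace ℝ (Fin d)}
  {E : Set (EuclideanSpace ℝ (Fin d))}

lemma mem_perSet {p : ℝ} : p ∈ perSet d E ↔ ∃ F, IsTestField F ∧ p = ∫ x in E, divg F x :=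
  ⟨fun ⟨F, h1, h2, h3, h4⟩ => ⟨F, ⟨h1, h2, h3⟩, h4⟩, fun ⟨F, h, h4⟩ => ⟨F, h.1, h.2, h.3, h4⟩⟩

lemma zero_mem_perSet : (0 : ℝ) ∈ perSet d E :=
  mem_perSet.2 ⟨0, ⟨contDiff_const, HasCompactSupport.zero, by simp⟩, by simp [divg]⟩

lemma perimeter_nonneg : 0 ≤ perimeter d E :=
  Real.sSup_nonneg' ⟨0, zero_mem_perSet, le_rfl⟩

lemma FinitePerimeter.setIntegral_divg_le (hE : FinitePerimeter d E) (hF : IsTestField F) :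
    ∫ x in E, divg F x ≤ perimeter d E :=
  le_csSup hE (mem_perSet.2 ⟨F, hF, rfl⟩)

lemma IsTestField.continuous_divg (hF : IsTestField F) : Continuous (divg F) := by
  have := hF.contDiff.continuous_fderiv one_ne_zero
  unfold divg
  fun_prop

lemma IsTestField.hasCompactSupport_divg (hF : IsTestField F) : HasCompactSupport (divg F) := by
  refine (hF.hasCompactSupport.fderiv (𝕜 := ℝ)).mono fun x hx => ?_
  contrapose! hx
  simp only [Function.mem_support, not_not] at hx ⊢
  simp [divg, hx]

lemma IsTestField.integrable_divg (hF : IsTestField F) : Integrable (divg F) :=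
  hF.continuous_divg.integrable_of_hasCompactSupport hF.hasCompactSupport_divg

lemma IsTestField.exists_abs_divg_le (hF : IsTestField F) : ∃ M, ∀ x, |divg F x| ≤ M :=
  hF.hasCompactSupport_divg.exists_bound_of_continuous hF.continuous_divg

lemma sum_single_smul (v : EuclideanSpace ℝ (Fin d)) :
    ∑ i, v i • EuclideanSpace.single i (1:ℝ) = v := by
  ext j
  simp [Finset.sum_apply, Pi.single_apply]

lemma divg_smul {φ : EuclideanSpace ℝ (Fin d) → ℝ} {x : EuclideanSpace ℝ (Fin d)}
    (hφ : DifferentiableAt ℝ φ x) (hF : DifferentiableAt ℝ F x) :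
    divg (fun y => φ y • F y) x = φ x * divg F x + fderiv ℝ φ x (F x) := by
  have h : fderiv ℝ φ x (F x) = ∑ i, F x i * fderiv ℝ φ x (EuclideanSpace.single i (1:ℝ)) := by
    conv_lhs => rw [← sum_single_smul (F x)]
    simp
  rw [h]
  simp only [divg, fderiv_fun_smul hφ hF, Finset.mul_sum, ← Finset.sum_add_distrib]
  simp [mul_comm]

lemma divg_add {x : EuclideanSpace ℝ (Fin d)}
    (hF : DifferentiableAt ℝ F x) (hG : DifferentiableAt ℝ G x) :
    divg (fun y => F y + G y) x = divg F x + divg G x := by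
  simp [divg, fderiv_fun_add hF hG, Finset.sum_add_distrib]

lemma divg_smul_const {φ : EuclideanSpace ℝ (Fin d) → ℝ} {x v : EuclideanSpace ℝ (Fin d)}
    (hφ : DifferentiableAt ℝ φ x) : divg (fun y => φ y • v) x = fderiv ℝ φ x v := by
  rw [divg_smul hφ (differentiableAt_const v)]
  simp [divg]

lemma divg_comp_add_right (a x : EuclideanSpace ℝ (Fin d)) :
    divg (fun y => F (y + a)) x = divg F (x + a) := by
  simp [divg, fderiv_comp_add_right]

lemma divg_comp_smul (c : ℝ) (x : EuclideanSpace ℝ (Fin d)) :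
    divg (fun y => F (c • y)) x = c * divg F (c • x) := by
  simp [divg, fderiv_comp_smul, Finset.mul_sum]

lemma IsTestField.comp_add_right (hF : IsTestField F) (a : EuclideanSpace ℝ (Fin d)) :
    IsTestField (fun y => F (y + a)) where
  contDiff := hF.contDiff.comp (contDiff_id.add contDiff_const)
  hasCompactSupport := hF.hasCompactSupport.comp_homeomorph (Homeomorph.addRight a)
  norm_le_one _ := hF.norm_le_one _

lemma IsTestField.comp_smul (hF : IsTestField F) {c : ℝ} (hc : c ≠ 0) :
    IsTestField (fun y => F (c • y)) where
  contDiff := hF.contDiff.comp (contDiff_const_smul c)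
  hasCompactSupport := hF.hasCompactSupport.comp_homeomorph (Homeomorph.smulOfNeZero c hc)
  norm_le_one _ := hF.norm_le_one _

lemma perSet_preimage_add_right_subset (a : EuclideanSpace ℝ (Fin d)) :
    perSet d E ⊆ perSet d ((· + a) ⁻¹' E) := by
  intro p hp
  obtain ⟨F, hF, rfl⟩ := mem_perSet.1 hp
  refine mem_perSet.2 ⟨_, hF.comp_add_right a, ?_⟩
  simp_rw [divg_comp_add_right]
  exact ((measurePreserving_add_right volume a).setIntegral_preimage_emb
    (Homeomorph.addRight a).measurableEmbedding _ _).symm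

lemma perSet_preimage_add_right (a : EuclideanSpace ℝ (Fin d)) :
    perSet d ((· + a) ⁻¹' E) = perSet d E := by
  refine (perSet_preimage_add_right_subset a).antisymm' ?_
  have h : (· + -a) ⁻¹' ((· + a) ⁻¹' E) = E := by
    ext x
    simp [add_assoc]
  simpa [h] using perSet_preimage_add_right_subset (E := (· + a) ⁻¹' E) (-a)

lemma FinitePerimeter.smul (hE : FinitePerimeter d E) {c : ℝ} (hc : 0 < c) :
    FinitePerimeter d (c • E) := by
  refine ⟨c ^ d * (c⁻¹ * perimeter d E), fun p hp => ?_⟩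
  obtain ⟨F, hF, rfl⟩ := mem_perSet.1 hp
  have h := hE.setIntegral_divg_le (hF.comp_smul hc.ne')
  simp_rw [divg_comp_smul] at h
  rw [integral_const_mul, Measure.setIntegral_comp_smul _ _ _ hc.ne', finrank_euclideanSpace,
    Fintype.card_fin, smul_eq_mul, abs_of_pos (by positivity)] at h
  have h2 := mul_le_mul_of_nonneg_left h (show 0 ≤ c ^ d * c⁻¹ by positivity)
  calc _ = c ^ d * c⁻¹ * (c * ((c ^ d)⁻¹ * ∫ x in c • E, divg F x)) := by
        field_simp
    _ ≤ _ := h2.trans_eq (by ring)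

lemma IsTestField.integral_divg (hF : IsTestField F) : ∫ x, divg F x = 0 := by
  have hd := hF.contDiff.continuous_fderiv one_ne_zero
  have hc := hF.contDiff.continuous
  have key : ∀ i, Integrable (fun x => fderiv ℝ F x (EuclideanSpace.single i (1:ℝ)) i) ∧
      ∫ x, fderiv ℝ F x (EuclideanSpace.single i (1:ℝ)) i = 0 := by
    intro i
    have h1 : Integrable (fun x => fderiv ℝ F x (EuclideanSpace.single i (1:ℝ)) i) := by
      refine Continuous.integrable_of_hasCompactSupport (by fun_prop) ?_
      refine (hF.hasCompactSupport.fderiv (𝕜 := ℝ)).mono fun x hx => ?_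
      contrapose! hx
      simp only [Function.mem_support, not_not] at hx ⊢
      simp [hx]
    have h2 : Integrable (fun x => F x i) := by
      refine Continuous.integrable_of_hasCompactSupport (by fun_prop) ?_
      refine hF.hasCompactSupport.mono fun x hx => ?_
      contrapose! hx
      simp only [Function.mem_support, not_not] at hx ⊢
      simp [hx]
    refine ⟨h1, ?_⟩
    have := integral_bilinear_hasLineDerivAt_right_eq_neg_left_of_integrable
      (μ := (volume : Measure (EuclideanSpace ℝ (Fin d))))
      (f := fun _ => (1:ℝ)) (f' := fun _ => 0) (g := fun x => F x i)
      (g' := fun x => fderiv ℝ F x (EuclideanSpace.single i (1:ℝ)) i)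
      (v := EuclideanSpace.single i (1:ℝ)) (B := ContinuousLinearMap.mul ℝ ℝ)
      (by simp) (by simpa using h1) (by simpa using h2)
      (fun x _ => by simpa [HasLineDerivAt] using hasDerivAt_const _ _) (fun x _ => by
        have h := (hF.contDiff.differentiable one_ne_zero x).hasFDerivAt
        exact ((EuclideanSpace.proj (𝕜 := ℝ) i).hasFDerivAt.comp x h).hasLineDerivAt _)
    simpa using this
  unfold divg
  rw [integral_finsetSum _ fun i _ => (key i).1]
  simp [fun i => (key i).2]

lemma finitePerimeter_univ : FinitePerimeter d univ := by
  refine ⟨0, fun p hp => ?_⟩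
  obtain ⟨F, hF, rfl⟩ := mem_perSet.1 hp
  simp [hF.integral_divg]

end Divergence

section Cut

open Real (smoothTransition)

lemma contDiff_smoothTransition : ContDiff ℝ 1 smoothTransition :=
  mod_cast Real.smoothTransition.contDiff (n := 1)

lemma deriv_smoothTransition_of_nonpos {s : ℝ} (hs : s ≤ 0) : deriv smoothTransition s = 0 := by
  refine IsLocalMin.deriv_eq_zero (Eventually.of_forall fun y => ?_)
  rw [Real.smoothTransition.zero_of_nonpos hs]
  exact Real.smoothTransition.nonneg y

lemma deriv_smoothTransition_of_one_le {s : ℝ} (hs : 1 ≤ s) : deriv smoothTransition s = 0 := by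
  refine IsLocalMax.deriv_eq_zero (Eventually.of_forall fun y => ?_)
  rw [Real.smoothTransition.one_of_one_le hs]
  exact Real.smoothTransition.le_one y

lemma exists_abs_deriv_smoothTransition_le :
    ∃ K : ℝ, 0 ≤ K ∧ ∀ s, |deriv smoothTransition s| ≤ K := by
  have hc : Continuous (deriv smoothTransition) :=
    contDiff_smoothTransition.continuous_deriv le_rfl
  have hs : HasCompactSupport (deriv smoothTransition) := by
    refine HasCompactSupport.intro (isCompact_Icc (a := (0:ℝ)) (b := 1)) fun s hs => ?_
    rw [mem_Icc, not_and_or, not_le, not_le] at hs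
    rcases hs with hs | hs
    · exact deriv_smoothTransition_of_nonpos hs.le
    · exact deriv_smoothTransition_of_one_le hs.le
  obtain ⟨K, hK⟩ := hs.exists_bound_of_continuous hc
  exact ⟨K, (norm_nonneg _).trans (hK 0), hK⟩

/-- A Lipschitz constant of `Real.smoothTransition`. -/
def stepBound : ℝ := exists_abs_deriv_smoothTransition_le.choose

lemma stepBound_nonneg : 0 ≤ stepBound := exists_abs_deriv_smoothTransition_le.choose_spec.1

lemma abs_deriv_smoothTransition_le (s : ℝ) : |deriv smoothTransition s| ≤ stepBound :=
  exists_abs_deriv_smoothTransition_le.choose_spec.2 s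

variable {d : ℕ} {F G : EuclideanSpace ℝ (Fin d) → EuclideanSpace ℝ (Fin d)}
  {E : Set (EuclideanSpace ℝ (Fin d))} {g : EuclideanSpace ℝ (Fin d) → ℝ}

lemma hasFDerivAt_smoothTransition_comp (hg : ContDiff ℝ 1 g) (x : EuclideanSpace ℝ (Fin d)) :
    HasFDerivAt (fun y => smoothTransition (g y)) (deriv smoothTransition (g x) • fderiv ℝ g x) x :=
  (contDiff_smoothTransition.differentiable one_ne_zero
    (g x)).hasDerivAt.comp_hasFDerivAt x (hg.differentiable one_ne_zero x).hasFDerivAt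

lemma isTestField_cut (hF : IsTestField F) (hG : IsTestField G) (hg : ContDiff ℝ 1 g) :
    IsTestField fun x => smoothTransition (g x) • F x + smoothTransition (-g x) • G x where
  contDiff := by
    have h1 := (contDiff_smoothTransition.comp hg).smul hF.contDiff
    have h2 := (contDiff_smoothTransition.comp hg.neg).smul hG.contDiff
    exact h1.add h2
  hasCompactSupport := by
    have h1 := hF.hasCompactSupport.smul_left (f := fun x => smoothTransition (g x))
    have h2 := hG.hasCompactSupport.smul_left (f := fun x => smoothTransition (-g x))
    exact h1.add h2
  norm_le_one x := by
    have key : ∀ (s : ℝ) (v : EuclideanSpace ℝ (Fin d)), ‖v‖ ≤ 1 →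
        ‖smoothTransition s • v‖ ≤ 1 := fun s v hv => by
      rw [norm_smul, Real.norm_of_nonneg (Real.smoothTransition.nonneg s)]
      exact mul_le_one₀ (Real.smoothTransition.le_one s) (norm_nonneg _) hv
    rcases le_total (g x) 0 with h | h
    · simpa [Real.smoothTransition.zero_of_nonpos h] using key _ _ (hG.norm_le_one x)
    · simpa [Real.smoothTransition.zero_of_nonpos (neg_nonpos.2 h)] using
        key _ _ (hF.norm_le_one x)

lemma divg_cut (hF : IsTestField F) (hG : IsTestField G) (hg : ContDiff ℝ 1 g)
    (x : EuclideanSpace ℝ (Fin d)) :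
    divg (fun x => smoothTransition (g x) • F x + smoothTransition (-g x) • G x) x =
      smoothTransition (g x) * divg F x + smoothTransition (-g x) * divg G x +
      (deriv smoothTransition (g x) * fderiv ℝ g x (F x) -
        deriv smoothTransition (-g x) * fderiv ℝ g x (G x)) := by
  have h1 := hasFDerivAt_smoothTransition_comp hg x
  have h2 := hasFDerivAt_smoothTransition_comp hg.neg x
  have hF' := hF.contDiff.differentiable one_ne_zero x
  have hG' := hG.contDiff.differentiable one_ne_zero x
  rw [divg_add (h1.differentiableAt.fun_smul hF') (h2.differentiableAt.fun_smul hG'),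
    divg_smul h1.differentiableAt hF', divg_smul h2.differentiableAt hG', h1.fderiv, h2.fderiv]
  have : fderiv ℝ (fun y => -g y) x = -fderiv ℝ g x := by simp
  rw [this]
  simp only [smul_apply, neg_apply, smul_eq_mul]
  ring

/-- Cutting a set of finite perimeter along a level set of `g` costs at most a multiple of
the upper density of the volume of thin layers around that level set. -/
lemma cut_add_le (hEm : MeasurableSet E) (hE : FinitePerimeter d E) (hg : ContDiff ℝ 1 g)
    (hg1 : ∀ x, ‖fderiv ℝ g x‖ ≤ 1) {t A : ℝ} (hA0 : 0 ≤ A)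
    (hA : ∀ᶠ δ in 𝓝[>] 0, volume (E ∩ g ⁻¹' closedBall t δ) ≤ ENNReal.ofReal (A * δ))
    (hF : IsTestField F) (hG : IsTestField G) :
    (∫ x in E ∩ {x | g x < t}, divg F x) + ∫ x in E ∩ {x | t ≤ g x}, divg G x ≤
      perimeter d E + 2 * stepBound * A := by
  obtain ⟨M, hM⟩ := hF.exists_abs_divg_le
  obtain ⟨N, hN⟩ := hG.exists_abs_divg_le
  have hgm : Measurable g := hg.continuous.measurable
  have hlt : MeasurableSet {x | g x < t} := hgm measurableSet_Iio
  set h : EuclideanSpace ℝ (Fin d) → ℝ := {x | g x < t}.piecewise (divg F) (divg G) with hh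
  have hh_int : IntegrableOn h E :=
    Integrable.piecewise hlt hF.integrable_divg.integrableOn hG.integrable_divg.integrableOn
      |>.integrableOn
  have hsplit : (∫ x in E ∩ {x | g x < t}, divg F x) + ∫ x in E ∩ {x | t ≤ g x}, divg G x
      = ∫ x in E, h x := by
    have hc : {x | t ≤ g x} = {x | g x < t}ᶜ := by ext; simp
    rw [← integral_inter_add_sdiff hlt hh_int, hc, sdiff_eq]
    congr 1
    · refine setIntegral_congr_fun (hEm.inter hlt) fun x hx => ?_
      exact (piecewise_eq_of_mem _ _ _ hx.2).symm
    · refine setIntegral_congr_fun (hEm.inter hlt.compl) fun x hx => ?_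
      exact (piecewise_eq_of_notMem _ _ _ hx.2).symm
  rw [hsplit]
  have hbound : ∀ᶠ δ in 𝓝[>] (0:ℝ), ∫ x in E, h x ≤
      perimeter d E + 2 * stepBound * A + 2 * (M + N) * A * δ := by
    filter_upwards [hA, self_mem_nhdsWithin] with δ hδ (hδ0 : 0 < δ)
    set S := E ∩ g ⁻¹' closedBall t δ with hS
    have hSm : MeasurableSet S := hEm.inter (hgm measurableSet_closedBall)
    set γ : EuclideanSpace ℝ (Fin d) → ℝ := fun x => δ⁻¹ * (t - g x) with hγ
    have hγc : ContDiff ℝ 1 γ := contDiff_const.mul (contDiff_const.sub hg)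
    have hγd : ∀ x v, ‖v‖ ≤ 1 → |fderiv ℝ γ x v| ≤ δ⁻¹ := fun x v hv => by
      have hd : fderiv ℝ γ x = δ⁻¹ • -fderiv ℝ g x := by
        have := hg.differentiable one_ne_zero x
        rw [hγ, fderiv_const_mul (by fun_prop), fderiv_const_sub]
      rw [hd]
      simp only [smul_apply, neg_apply, smul_eq_mul,
        abs_mul, abs_neg, abs_of_pos (inv_pos.2 hδ0)]
      refine mul_le_of_le_one_right (inv_pos.2 hδ0).le ?_
      exact ((fderiv ℝ g x).le_opNorm v).trans (mul_le_one₀ (hg1 x) (norm_nonneg _) hv)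
    set X := fun x => smoothTransition (γ x) • F x + smoothTransition (-γ x) • G x with hX
    have hXt : IsTestField X := isTestField_cut hF hG hγc
    have hoff : ∀ x ∈ E \ S, h x = divg X x := fun x hx => by
      have hx' : δ < |g x - t| := by
        have : ¬ g x ∈ closedBall t δ := fun hb => hx.2 ⟨hx.1, hb⟩
        simpa [Real.dist_eq] using this
      rw [hX, divg_cut hF hG hγc]
      rcases lt_or_ge (g x) t with hxt | hxt
      · have h1 : 1 ≤ γ x := by
          rw [abs_of_neg (by linarith)] at hx'
          simp only [hγ]
          rw [le_inv_mul_iff₀ hδ0]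
          linarith
        have h2 : -γ x ≤ 0 := by linarith
        rw [show h x = divg F x from piecewise_eq_of_mem {x | g x < t} _ _ hxt,
          Real.smoothTransition.one_of_one_le h1,
          Real.smoothTransition.zero_of_nonpos h2, deriv_smoothTransition_of_nonpos h2,
          deriv_smoothTransition_of_one_le h1]
        ring
      · have h1 : 1 ≤ -γ x := by
          rw [abs_of_nonneg (by linarith)] at hx'
          simp only [hγ]
          rw [← mul_neg, le_inv_mul_iff₀ hδ0]
          linarith
        have h2 : γ x ≤ 0 := by linarith
        rw [show h x = divg G x from
            piecewise_eq_of_notMem {x | g x < t} _ _ (fun h' => not_lt.2 hxt h'),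
          Real.smoothTransition.one_of_one_le h1,
          Real.smoothTransition.zero_of_nonpos h2, deriv_smoothTransition_of_nonpos h2,
          deriv_smoothTransition_of_one_le h1]
        ring
    have hon : ∀ x, h x ≤ divg X x + (2 * (M + N) + 2 * stepBound * δ⁻¹) := fun x => by
      have hs : ∀ s y B, |y| ≤ B → |smoothTransition s * y| ≤ B := fun s y B hy => by
        rw [abs_mul, abs_of_nonneg (Real.smoothTransition.nonneg s)]
        exact (mul_le_of_le_one_left (abs_nonneg _) (Real.smoothTransition.le_one s)).trans hy
      have hs' : ∀ s v, ‖v‖ ≤ 1 → |deriv smoothTransition s * fderiv ℝ γ x v| ≤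
          stepBound * δ⁻¹ := fun s v hv => by
        rw [abs_mul]
        exact mul_le_mul (abs_deriv_smoothTransition_le s) (hγd x v hv) (abs_nonneg _)
          stepBound_nonneg
      have e1 := abs_le.1 (hs (γ x) _ _ (hM x))
      have e2 := abs_le.1 (hs (-γ x) _ _ (hN x))
      have e3 := abs_le.1 (hs' (γ x) _ (hF.norm_le_one x))
      have e4 := abs_le.1 (hs' (-γ x) _ (hG.norm_le_one x))
      have e5 : h x ≤ M + N := by
        have := (abs_nonneg _).trans (hM x)
        have := (abs_nonneg _).trans (hN x)
        simp only [hh, Set.piecewise]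
        split_ifs
        · linarith [(abs_le.1 (hM x)).2]
        · linarith [(abs_le.1 (hN x)).2]
      rw [hX, divg_cut hF hG hγc]
      linarith [e1.1, e2.1, e3.1, e4.2]
    have hSE : S ⊆ E := inter_subset_left
    have hvol : volume.real S ≤ A * δ :=
      ENNReal.toReal_le_of_le_ofReal (by positivity) hδ
    have hSfin : volume S ≠ ∞ := (hδ.trans_lt ENNReal.ofReal_lt_top).ne
    have hXi : Integrable (divg X) := hXt.integrable_divg
    have hSi : ∫ x in S, h x ≤
        (∫ x in S, divg X x) + (2 * (M + N) + 2 * stepBound * δ⁻¹) * (A * δ) := by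
      have hci : IntegrableOn (fun _ => (2 * (M + N) + 2 * stepBound * δ⁻¹)) S :=
        integrableOn_const hSfin
      calc ∫ x in S, h x ≤ ∫ x in S, (divg X x + (2 * (M + N) + 2 * stepBound * δ⁻¹)) :=
            setIntegral_mono (hh_int.mono_set hSE) (hXi.integrableOn.add hci) hon
        _ = (∫ x in S, divg X x) + volume.real S * (2 * (M + N) + 2 * stepBound * δ⁻¹) := by
            rw [integral_add hXi.integrableOn hci, setIntegral_const, smul_eq_mul]
        _ ≤ _ := by
            have : 0 ≤ 2 * (M + N) + 2 * stepBound * δ⁻¹ := by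
              have := (abs_nonneg _).trans (hM 0)
              have := (abs_nonneg _).trans (hN 0)
              have := stepBound_nonneg
              positivity
            rw [mul_comm (volume.real S)]
            gcongr
    have hD : ∫ x in E \ S, h x = ∫ x in E \ S, divg X x :=
      setIntegral_congr_fun (hEm.diff hSm) hoff
    have h1 := integral_inter_add_sdiff hSm hh_int
    have h2 := integral_inter_add_sdiff hSm (hXi.integrableOn (s := E))
    rw [inter_eq_right.2 hSE] at h1 h2
    have h3 := hE.setIntegral_divg_le hXt
    have h4 : (2 * (M + N) + 2 * stepBound * δ⁻¹) * (A * δ) =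
        2 * stepBound * A + 2 * (M + N) * A * δ := by
      field_simp
      ring
    linarith
  have hlim : Tendsto (fun δ : ℝ => perimeter d E + 2 * stepBound * A + 2 * (M + N) * A * δ)
      (𝓝[>] 0) (𝓝 (perimeter d E + 2 * stepBound * A + 2 * (M + N) * A * 0)) :=
    (Continuous.tendsto (by fun_prop) 0).mono_left nhdsWithin_le_nhds
  rw [mul_zero, add_zero] at hlim
  exact ge_of_tendsto hlim hbound

lemma perimeter_le_of_forall {c : ℝ} (h : ∀ F, IsTestField F → ∫ x in E, divg F x ≤ c) :
    FinitePerimeter d E ∧ perimeter d E ≤ c := by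
  have hub : c ∈ upperBounds (perSet d E) := by
    intro p hp
    obtain ⟨F, hF, rfl⟩ := mem_perSet.1 hp
    exact h F hF
  exact ⟨⟨c, hub⟩, csSup_le ⟨0, zero_mem_perSet⟩ hub⟩

lemma isTestField_zero : IsTestField (0 : EuclideanSpace ℝ (Fin d) → EuclideanSpace ℝ (Fin d)) :=
  ⟨contDiff_const, HasCompactSupport.zero, by simp⟩

lemma divg_zero (x : EuclideanSpace ℝ (Fin d)) :
    divg (0 : EuclideanSpace ℝ (Fin d) → EuclideanSpace ℝ (Fin d)) x = 0 := by
  simp [divg]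

lemma FinitePerimeter.cut (hEm : MeasurableSet E) (hE : FinitePerimeter d E)
    (hg : ContDiff ℝ 1 g) (hg1 : ∀ x, ‖fderiv ℝ g x‖ ≤ 1) {t A : ℝ} (hA0 : 0 ≤ A)
    (hA : ∀ᶠ δ in 𝓝[>] 0, volume (E ∩ g ⁻¹' closedBall t δ) ≤ ENNReal.ofReal (A * δ)) :
    FinitePerimeter d (E ∩ {x | g x < t}) ∧ FinitePerimeter d (E ∩ {x | t ≤ g x}) ∧
      perimeter d (E ∩ {x | g x < t}) + perimeter d (E ∩ {x | t ≤ g x}) ≤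
        perimeter d E + 2 * stepBound * A := by
  refine ⟨(perimeter_le_of_forall (c := perimeter d E + 2 * stepBound * A) fun F hF => ?_).1,
    (perimeter_le_of_forall (c := perimeter d E + 2 * stepBound * A) fun F hF => ?_).1, ?_⟩
  · simpa [divg_zero] using cut_add_le hEm hE hg hg1 hA0 hA hF isTestField_zero
  · simpa [divg_zero] using cut_add_le hEm hE hg hg1 hA0 hA isTestField_zero hF
  · rw [← le_sub_iff_add_le]
    refine (perimeter_le_of_forall fun F hF => ?_).2
    rw [le_sub_comm]
    refine (perimeter_le_of_forall fun G hG => ?_).2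
    linarith [cut_add_le hEm hE hg hg1 hA0 hA hF hG]

/-- The density at height `t` of the volume of `E` sliced by `g`. -/
def sliceDensity (E : Set (EuclideanSpace ℝ (Fin d))) (g : EuclideanSpace ℝ (Fin d) → ℝ) :
    ℝ → ℝ≥0∞ :=
  ((volume.restrict E).map g).rnDeriv volume

lemma setLIntegral_sliceDensity_le (hgm : Measurable g) (s : Set ℝ) :
    ∫⁻ t in s, sliceDensity E g t ≤ volume E := by
  refine (Measure.setLIntegral_rnDeriv_le s).trans ((measure_mono (subset_univ s)).trans ?_)
  rw [Measure.map_apply hgm MeasurableSet.univ]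
  simp

lemma ae_eventually_volume_inter_preimage_closedBall_le (hEv : volume E ≠ ∞)
    (hgm : Measurable g) :
    ∀ᵐ t, sliceDensity E g t < ∞ ∧ ∀ b, (sliceDensity E g t).toReal < b → ∀ᶠ δ in 𝓝[>] 0,
      volume (E ∩ g ⁻¹' closedBall t δ) ≤ ENNReal.ofReal (2 * b * δ) := by
  have : IsFiniteMeasure (volume.restrict E) := ⟨by simpa using hEv.lt_top⟩
  have : IsFiniteMeasure ((volume.restrict E).map g) := Measure.isFiniteMeasure_map _ _
  filter_upwards [Besicovitch.ae_tendsto_rnDeriv ((volume.restrict E).map g) volume,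
    Measure.rnDeriv_lt_top ((volume.restrict E).map g) volume] with t ht hfin
  change Tendsto _ _ (𝓝 (sliceDensity E g t)) at ht
  change sliceDensity E g t < ∞ at hfin
  refine ⟨hfin, fun b hb => ?_⟩
  have hb0 : 0 < b := ENNReal.toReal_nonneg.trans_lt hb
  have hlt : sliceDensity E g t < ENNReal.ofReal b := by
    rw [← ENNReal.ofReal_toReal hfin.ne]
    exact ENNReal.ofReal_lt_ofReal_iff hb0 |>.2 hb
  filter_upwards [ht.eventually_lt_const hlt, self_mem_nhdsWithin] with δ hδ (hδ0 : 0 < δ)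
  rw [Measure.map_apply hgm measurableSet_closedBall,
    Measure.restrict_apply (hgm measurableSet_closedBall), Real.volume_closedBall,
    inter_comm] at hδ
  rw [ENNReal.div_lt_iff (Or.inl (by simp [hδ0])) (Or.inl ENNReal.ofReal_ne_top),
    ← ENNReal.ofReal_mul hb0.le] at hδ
  refine hδ.le.trans_eq ?_
  ring_nf

lemma ae_cut (hEm : MeasurableSet E) (hE : FinitePerimeter d E) (hEv : volume E ≠ ∞)
    (hg : ContDiff ℝ 1 g) (hg1 : ∀ x, ‖fderiv ℝ g x‖ ≤ 1) :
    ∀ᵐ t, sliceDensity E g t < ∞ ∧ FinitePerimeter d (E ∩ {x | g x < t}) ∧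
      FinitePerimeter d (E ∩ {x | t ≤ g x}) ∧
      perimeter d (E ∩ {x | g x < t}) + perimeter d (E ∩ {x | t ≤ g x}) ≤
        perimeter d E + 4 * stepBound * (sliceDensity E g t).toReal := by
  filter_upwards [ae_eventually_volume_inter_preimage_closedBall_le hEv
    hg.continuous.measurable] with t ⟨hfin, hev⟩
  set a := (sliceDensity E g t).toReal with ha
  have ha0 : 0 ≤ a := ENNReal.toReal_nonneg
  have hcut := fun (b : ℝ) (hb : a < b) => hE.cut hEm hg hg1 (by linarith : 0 ≤ 2 * b) (hev b hb)
  refine ⟨hfin, (hcut (a + 1) (by linarith)).1, (hcut (a + 1) (by linarith)).2.1, ?_⟩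
  have hlim : Tendsto (fun b : ℝ => perimeter d E + 2 * stepBound * (2 * b)) (𝓝[>] a)
      (𝓝 (perimeter d E + 2 * stepBound * (2 * a))) :=
    (Continuous.tendsto (by fun_prop) a).mono_left nhdsWithin_le_nhds
  have := ge_of_tendsto hlim (by
    filter_upwards [self_mem_nhdsWithin] with b hb using (hcut b hb).2.2)
  linarith

/-- Between any two heights there is a level set along which cutting is cheap. -/
lemma exists_cut (hEm : MeasurableSet E) (hE : FinitePerimeter d E) (hEv : volume E ≠ ∞)
    (hg : ContDiff ℝ 1 g) (hg1 : ∀ x, ‖fderiv ℝ g x‖ ≤ 1) {a b : ℝ} (hab : a < b) :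
    ∃ t ∈ Ioo a b, FinitePerimeter d (E ∩ {x | g x < t}) ∧
      FinitePerimeter d (E ∩ {x | t ≤ g x}) ∧
      perimeter d (E ∩ {x | g x < t}) + perimeter d (E ∩ {x | t ≤ g x}) ≤
        perimeter d E + 4 * stepBound * (volume.real E / (b - a)) := by
  have hgm : Measurable g := hg.continuous.measurable
  have hI : volume.restrict (Ioo a b) ≠ 0 := by
    simp [Measure.restrict_eq_zero, hab]
  have hle := setLIntegral_sliceDensity_le (E := E) hgm (Ioo a b)
  have hae := (ae_restrict_of_ae (s := Ioo a b) (ae_cut hEm hE hEv hg hg1)).and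
    (ae_restrict_mem measurableSet_Ioo)
  have hm : Measurable (sliceDensity E g) := Measure.measurable_rnDeriv _ _
  obtain ⟨t, ht, h2⟩ := exists_notMem_null_le_laverage hI hm.aemeasurable (ae_iff.1 hae)
  rw [mem_ofPred_eq, not_not] at ht
  obtain ⟨⟨h1, h3, h4, h5⟩, hmem⟩ := ht
  refine ⟨t, hmem, h3, h4, h5.trans ?_⟩
  have h6 : (sliceDensity E g t).toReal ≤ volume.real E / (b - a) := by
    refine ENNReal.toReal_le_of_le_ofReal (by have := sub_pos.2 hab; positivity) (h2.trans ?_)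
    rw [laverage_eq, Measure.restrict_apply MeasurableSet.univ, univ_inter, Real.volume_Ioo,
      ENNReal.ofReal_div_of_pos (sub_pos.2 hab), ofReal_measureReal hEv]
    gcongr
  have := stepBound_nonneg
  gcongr

end Cut

section Translation

variable {d : ℕ} {E : Set (EuclideanSpace ℝ (Fin d))}

lemma FinitePerimeter.abs_integral_fderiv_le (hE : FinitePerimeter d E)
    {φ : EuclideanSpace ℝ (Fin d) → ℝ} (hφ : ContDiff ℝ 1 φ) (hφc : HasCompactSupport φ)
    (hφ1 : ∀ x, |φ x| ≤ 1) (h : EuclideanSpace ℝ (Fin d)) :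
    |∫ x in E, fderiv ℝ φ x h| ≤ ‖h‖ * perimeter d E := by
  have key : ∀ h : EuclideanSpace ℝ (Fin d),
      ∫ x in E, fderiv ℝ φ x h ≤ ‖h‖ * perimeter d E := fun h => by
    rcases eq_or_ne h 0 with rfl | hh
    · simp
    have hpos : 0 < ‖h‖ := norm_pos_iff.2 hh
    have ht : IsTestField fun x => φ x • (‖h‖⁻¹ • h) :=
      { contDiff := hφ.smul contDiff_const
        hasCompactSupport := hφc.smul_right
        norm_le_one := fun x => by
          rw [norm_smul, norm_smul, norm_inv, norm_norm, inv_mul_cancel₀ hpos.ne', mul_one]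
          exact hφ1 x }
    have h1 := hE.setIntegral_divg_le ht
    simp_rw [divg_smul_const (hφ.differentiable one_ne_zero _), map_smul, smul_eq_mul] at h1
    rwa [integral_const_mul, inv_mul_le_iff₀ hpos] at h1
  rw [abs_le]
  refine ⟨?_, key h⟩
  have := key (-h)
  simp only [map_neg, integral_neg, norm_neg] at this
  linarith

lemma FinitePerimeter.abs_integral_translate_sub_le (hE : FinitePerimeter d E)
    (hEv : volume E ≠ ∞) {φ : EuclideanSpace ℝ (Fin d) → ℝ} (hφ : ContDiff ℝ 1 φ)
    (hφc : HasCompactSupport φ) (hφ1 : ∀ x, |φ x| ≤ 1) (h : EuclideanSpace ℝ (Fin d)) :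
    |(∫ x in E, φ (x + h)) - ∫ x in E, φ x| ≤ ‖h‖ * perimeter d E := by
  have : IsFiniteMeasure (volume.restrict E) := ⟨by simpa using hEv.lt_top⟩
  have hdc := hφ.continuous_fderiv one_ne_zero
  obtain ⟨M, hM⟩ := (hφc.fderiv (𝕜 := ℝ)).exists_bound_of_continuous hdc
  have hc := hφ.continuous
  have hshift : ∀ s : ℝ, HasCompactSupport fun x => φ (x + s • h) := fun s =>
    hφc.comp_homeomorph (Homeomorph.addRight (s • h))
  have hder : ∀ s : ℝ, HasDerivAt (fun s : ℝ => ∫ x in E, φ (x + s • h))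
      (∫ x in E, fderiv ℝ φ (x + s • h) h) s := fun s => by
    refine (hasDerivAt_integral_of_dominated_loc_of_deriv_le (s := univ)
      (F' := fun s x => fderiv ℝ φ (x + s • h) h) (bound := fun _ => M * ‖h‖) univ_mem
      (Eventually.of_forall fun s => ?_) ?_ ?_ ?_ (integrable_const _) ?_).2
    · exact Continuous.aestronglyMeasurable (by fun_prop)
    · exact (Continuous.integrable_of_hasCompactSupport (by fun_prop) (hshift s)).integrableOn
    · exact Continuous.aestronglyMeasurable (by fun_prop)
    · exact Eventually.of_forall fun x s _ => (fderiv ℝ φ (x + s • h)).le_of_opNorm_le (hM _) h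
    · refine Eventually.of_forall fun x s _ => ?_
      have h1 : HasDerivAt (fun s : ℝ => x + s • h) h s := by
        simpa using ((hasDerivAt_id s).smul_const h).const_add x
      exact (hφ.differentiable one_ne_zero _).hasFDerivAt.comp_hasDerivAt s h1
  have hle : ∀ s : ℝ, ‖∫ x in E, fderiv ℝ φ (x + s • h) h‖ ≤ ‖h‖ * perimeter d E := fun s => by
    have := hE.abs_integral_fderiv_le (φ := fun x => φ (x + s • h))
      (hφ.comp (contDiff_id.add contDiff_const)) (hshift s) (fun x => hφ1 _) h
    rw [Real.norm_eq_abs]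
    simpa only [fderiv_comp_add_right] using this
  have := norm_image_sub_le_of_norm_deriv_le_segment_01'
    (fun s _ => (hder s).hasDerivWithinAt) (fun s _ => hle s)
  simpa using this

lemma FinitePerimeter.lintegral_translate_sub_le (hE : FinitePerimeter d E)
    (hEm : MeasurableSet E) (hEv : volume E ≠ ∞) (h : EuclideanSpace ℝ (Fin d)) :
    ∫⁻ x, ‖E.indicator (fun _ => (1:ℝ)) (x + h) - E.indicator (fun _ => (1:ℝ)) x‖ₑ ≤
      ENNReal.ofReal (‖h‖ * perimeter d E) := by
  set u : EuclideanSpace ℝ (Fin d) → ℝ := E.indicator (fun _ => (1:ℝ)) with hu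
  have hui : Integrable u := (integrable_indicator_iff hEm).2 (integrableOn_const hEv)
  have huh : Integrable fun x => u (x + h) := hui.comp_add_right h
  set g : EuclideanSpace ℝ (Fin d) → ℝ := fun x => u (x + h) - u x with hg
  have hgi : Integrable g := huh.sub hui
  have hg3 : ∀ x, g x = -1 ∨ g x = 0 ∨ g x = 1 := fun x => by
    simp only [hg, hu, indicator]
    split_ifs <;> simp
  have main : ∀ ε : ℝ, 0 < ε → ∫ x, |g x| ≤ ‖h‖ * perimeter d E + Real.pi / 2 * ε := by
    intro ε hε
    obtain ⟨ψ, hψc, hψ, hψε⟩ := (memLp_one_iff_integrable.2 hgi).exist_eLpNorm_sub_le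
      ENNReal.one_ne_top le_rfl hε
    set φ : EuclideanSpace ℝ (Fin d) → ℝ := fun x => Real.sin (Real.pi / 2 * ψ x) with hφ
    have hφd : ContDiff ℝ 1 φ :=
      Real.contDiff_sin.comp (contDiff_const.mul (hψ.of_le (by exact_mod_cast le_top)))
    have hφc : HasCompactSupport φ := hψc.comp_left (g := fun t => Real.sin (Real.pi / 2 * t))
      (by simp)
    have hφ1 : ∀ x, |φ x| ≤ 1 := fun x => Real.abs_sin_le_one _
    have hφi : Integrable φ := hφd.continuous.integrable_of_hasCompactSupport hφc
    have hψi : Integrable ψ := hψ.continuous.integrable_of_hasCompactSupport hψc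
    have hdiff : ∀ x, |g x| ≤ g x * φ x + Real.pi / 2 * |g x - ψ x| := fun x => by
      have h1 : g x = Real.sin (Real.pi / 2 * g x) := by
        rcases hg3 x with e | e | e <;> simp [e]
      have h2 : |g x - φ x| ≤ Real.pi / 2 * |g x - ψ x| := by
        conv_lhs => rw [h1]
        refine (Real.abs_sin_sub_sin_le _ _).trans_eq ?_
        rw [← mul_sub, abs_mul, abs_of_pos (by positivity)]
      have h3 := abs_le.1 h2
      rcases hg3 x with e | e | e <;> rw [e] at h3 ⊢ <;> norm_num <;>
        first | positivity | linarith [h3.1, h3.2]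
    have hgφ : Integrable fun x => g x * φ x :=
      hgi.mul_bdd (c := 1) hφi.aestronglyMeasurable (Eventually.of_forall hφ1)
    have hsub : Integrable fun x => Real.pi / 2 * |g x - ψ x| := (hgi.sub hψi).abs.const_mul _
    have hεi : ∫ x, |g x - ψ x| ≤ ε := by
      have e : ∫ x, |g x - ψ x| = (eLpNorm (g - ψ) 1 volume).toReal := by
        rw [eLpNorm_one_eq_lintegral_enorm]
        exact integral_norm_eq_lintegral_enorm (hgi.sub hψi).aestronglyMeasurable
      rw [e]
      exact ENNReal.toReal_le_of_le_ofReal hε.le hψε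
    have hgφ' : ∫ x, g x * φ x ≤ ‖h‖ * perimeter d E := by
      have e1 : ∫ x, u (x + h) * φ x = ∫ x in E, φ (x + -h) := by
        rw [← integral_indicator hEm,
          ← integral_add_right_eq_self (E.indicator fun x => φ (x + -h)) h]
        refine integral_congr_ae (Eventually.of_forall fun x => ?_)
        simp only [hu, indicator]
        split_ifs <;> simp
      have e2 : ∫ x, u x * φ x = ∫ x in E, φ x := by
        rw [← integral_indicator hEm]
        refine integral_congr_ae (Eventually.of_forall fun x => ?_)
        simp only [hu, indicator]
        split_ifs <;> simp
      have i1 : Integrable fun x => u (x + h) * φ x :=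
        huh.mul_bdd (c := 1) hφi.aestronglyMeasurable (Eventually.of_forall hφ1)
      have i2 : Integrable fun x => u x * φ x :=
        hui.mul_bdd (c := 1) hφi.aestronglyMeasurable (Eventually.of_forall hφ1)
      have e3 : ∫ x, g x * φ x = (∫ x in E, φ (x + -h)) - ∫ x in E, φ x := by
        rw [← e1, ← e2, ← integral_sub i1 i2]
        simp only [hg, sub_mul]
      rw [e3, ← norm_neg h]
      exact (le_abs_self _).trans (hE.abs_integral_translate_sub_le hEv hφd hφc hφ1 (-h))
    calc ∫ x, |g x| ≤ ∫ x, (g x * φ x + Real.pi / 2 * |g x - ψ x|) :=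
          integral_mono hgi.abs (hgφ.add hsub) hdiff
      _ = (∫ x, g x * φ x) + Real.pi / 2 * ∫ x, |g x - ψ x| := by
          rw [integral_add hgφ hsub, integral_const_mul]
      _ ≤ _ := by gcongr
  have hlim : ∫ x, |g x| ≤ ‖h‖ * perimeter d E := by
    refine le_of_forall_pos_le_add fun ε hε => ?_
    have := main (ε / (Real.pi / 2)) (by positivity)
    rwa [mul_div_cancel₀ _ (by positivity)] at this
  calc ∫⁻ x, ‖g x‖ₑ = ENNReal.ofReal (∫ x, ‖g x‖) :=
        (ofReal_integral_norm_eq_lintegral_enorm hgi).symm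
    _ ≤ _ := ENNReal.ofReal_le_ofReal hlim

lemma measurable_indicator_one (hEm : MeasurableSet E) :
    Measurable (E.indicator (fun _ => (1:ℝ))) :=
  measurable_const.indicator hEm

lemma FinitePerimeter.lintegral_ball_translate_sub_le (hE : FinitePerimeter d E)
    (hEm : MeasurableSet E) (hEv : volume E ≠ ∞) (ρ : ℝ) :
    ∫⁻ x, ∫⁻ h in ball (0 : EuclideanSpace ℝ (Fin d)) ρ,
      ‖E.indicator (fun _ => (1:ℝ)) (x + h) - E.indicator (fun _ => (1:ℝ)) x‖ₑ ≤
      ENNReal.ofReal (ρ * perimeter d E) * volume (ball (0 : EuclideanSpace ℝ (Fin d)) ρ) := by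
  have hm := measurable_indicator_one hEm
  rw [lintegral_lintegral_swap (Measurable.aemeasurable (by fun_prop))]
  rw [← setLIntegral_const]
  refine setLIntegral_mono measurable_const fun h hh => ?_
  refine (hE.lintegral_translate_sub_le hEm hEv h).trans (ENNReal.ofReal_le_ofReal ?_)
  have := perimeter_nonneg (E := E)
  rw [mem_ball_zero_iff] at hh
  gcongr

lemma setLIntegral_enorm_indicator_add (hEm : MeasurableSet E) (x : EuclideanSpace ℝ (Fin d))
    (ρ : ℝ) : ∫⁻ h in ball (0 : EuclideanSpace ℝ (Fin d)) ρ,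
      ‖E.indicator (fun _ => (1:ℝ)) (x + h)‖ₑ = volume (E ∩ ball x ρ) := by
  have h1 : ∀ h, ‖E.indicator (fun _ => (1:ℝ)) (x + h)‖ₑ =
      ((x + ·) ⁻¹' E).indicator (fun _ => (1:ℝ≥0∞)) h := fun h => by
    by_cases hx : x + h ∈ E <;> simp [hx, indicator]
  simp_rw [h1]
  have hxm : MeasurableSet ((x + ·) ⁻¹' E) := measurable_const_add x hEm
  rw [lintegral_indicator_const hxm, one_mul, Measure.restrict_apply hxm,
    ← (measurePreserving_add_left volume x).measure_preimage
      (hEm.inter measurableSet_ball).nullMeasurableSet]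
  congr 1
  ext h
  simp

/-- A set with small perimeter-to-volume ratio has a definite amount of mass in some ball. -/
lemma FinitePerimeter.exists_le_volume_inter_ball (hE : FinitePerimeter d E)
    (hEm : MeasurableSet E) (hEv : volume E ≠ ∞) {ρ : ℝ} (hρ : 0 < ρ)
    (h : ρ * perimeter d E < volume.real E / 2) :
    ∃ a, volume (ball (0 : EuclideanSpace ℝ (Fin d)) ρ) / 2 ≤ volume (E ∩ ball a ρ) := by
  by_contra! hcon
  set b := volume (ball (0 : EuclideanSpace ℝ (Fin d)) ρ) with hb
  have hb0 : b ≠ 0 := (measure_ball_pos _ _ hρ).ne'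
  have hbt : b ≠ ∞ := measure_ball_lt_top.ne
  have hm := measurable_indicator_one hEm
  have h1 : ∀ x ∈ E, b / 2 ≤ ∫⁻ h in ball (0 : EuclideanSpace ℝ (Fin d)) ρ,
      ‖E.indicator (fun _ => (1:ℝ)) (x + h) - E.indicator (fun _ => (1:ℝ)) x‖ₑ := fun x hx => by
    have h2 : b ≤ (∫⁻ h in ball (0 : EuclideanSpace ℝ (Fin d)) ρ,
        ‖E.indicator (fun _ => (1:ℝ)) (x + h) - E.indicator (fun _ => (1:ℝ)) x‖ₑ) +
        volume (E ∩ ball x ρ) := by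
      rw [← setLIntegral_enorm_indicator_add hEm, ← lintegral_add_left (by fun_prop), hb,
        ← setLIntegral_one]
      refine lintegral_mono fun h => ?_
      by_cases hxh : x + h ∈ E <;> simp [hx, hxh, indicator]
    by_contra! hlt
    have := ENNReal.add_lt_add hlt (hcon x)
    rw [ENNReal.add_halves] at this
    exact absurd h2 (not_le.2 this)
  have h3 : b / 2 * volume E ≤ ENNReal.ofReal (ρ * perimeter d E) * b := by
    refine le_trans ?_ (hE.lintegral_ball_translate_sub_le hEm hEv ρ)
    rw [← setLIntegral_const]
    exact (setLIntegral_mono' hEm h1).trans (setLIntegral_le_lintegral _ _)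
  have h4 := ENNReal.toReal_mono (ENNReal.mul_ne_top ENNReal.ofReal_ne_top hbt) h3
  have hP := perimeter_nonneg (E := E)
  rw [ENNReal.toReal_mul, ENNReal.toReal_mul, ENNReal.toReal_div,
    ENNReal.toReal_ofReal (by positivity)] at h4
  have hbr : 0 < b.toReal := ENNReal.toReal_pos hb0 hbt
  simp only [ENNReal.toReal_ofNat] at h4
  rw [measureReal_def] at h
  have h5 := mul_lt_mul_of_pos_right h hbr
  linarith

lemma volume_ball_mul_enorm_sub_le (hEm : MeasurableSet E) {ρ : ℝ} (hρ : 0 < ρ)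
    (x : EuclideanSpace ℝ (Fin d)) :
    volume (ball (0 : EuclideanSpace ℝ (Fin d)) ρ) * ‖E.indicator (fun _ => (1:ℝ)) x -
      volume.real (E ∩ ball x ρ) / volume.real (ball (0 : EuclideanSpace ℝ (Fin d)) ρ)‖ₑ ≤
    ∫⁻ h in ball (0 : EuclideanSpace ℝ (Fin d)) ρ,
      ‖E.indicator (fun _ => (1:ℝ)) (x + h) - E.indicator (fun _ => (1:ℝ)) x‖ₑ := by
  set B := ball (0 : EuclideanSpace ℝ (Fin d)) ρ
  have hBt : volume B ≠ ∞ := measure_ball_lt_top.ne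
  have hB0 : volume.real B ≠ 0 := (ENNReal.toReal_pos (measure_ball_pos _ _ hρ).ne' hBt).ne'
  have hm := measurable_indicator_one hEm
  have : IsFiniteMeasure (volume.restrict B) := ⟨by simpa using hBt.lt_top⟩
  have hxm : MeasurableSet ((x + ·) ⁻¹' E) := measurable_const_add x hEm
  have i1 : IntegrableOn (fun h => E.indicator (fun _ => (1:ℝ)) (x + h)) B := by
    refine Integrable.of_bound (C := 1) (Measurable.aestronglyMeasurable (by fun_prop))
      (Eventually.of_forall fun h => ?_)
    by_cases hh : x + h ∈ E <;> simp [hh]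
  have e1 : ∫ h in B, E.indicator (fun _ => (1:ℝ)) (x + h) = volume.real (E ∩ ball x ρ) := by
    rw [integral_eq_lintegral_of_nonneg_ae (Eventually.of_forall fun h =>
      indicator_nonneg (fun _ _ => zero_le_one) _) i1.aestronglyMeasurable, measureReal_def,
      ← setLIntegral_enorm_indicator_add hEm]
    congr 1
    refine lintegral_congr fun h => ?_
    rw [Real.enorm_of_nonneg (indicator_nonneg (fun _ _ => zero_le_one) _)]
  have e2 : ∫ h in B, (E.indicator (fun _ => (1:ℝ)) (x + h) - E.indicator (fun _ => (1:ℝ)) x) =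
      -(volume.real B * (E.indicator (fun _ => (1:ℝ)) x -
        volume.real (E ∩ ball x ρ) / volume.real B)) := by
    rw [integral_sub i1 (integrable_const _), e1, setIntegral_const, smul_eq_mul]
    field_simp
    ring
  refine le_trans (le_of_eq ?_) (enorm_integral_le_lintegral_enorm _)
  rw [e2, enorm_neg, enorm_mul, Real.enorm_of_nonneg measureReal_nonneg, ofReal_measureReal hBt]

lemma FinitePerimeter.lintegral_indicator_sub_average_le (hE : FinitePerimeter d E)
    (hEm : MeasurableSet E) (hEv : volume E ≠ ∞) {ρ : ℝ} (hρ : 0 < ρ) :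
    ∫⁻ x, ‖E.indicator (fun _ => (1:ℝ)) x -
      volume.real (E ∩ ball x ρ) / volume.real (ball (0 : EuclideanSpace ℝ (Fin d)) ρ)‖ₑ ≤
    ENNReal.ofReal (ρ * perimeter d E) := by
  set b := volume (ball (0 : EuclideanSpace ℝ (Fin d)) ρ) with hb
  have hb0 : b ≠ 0 := (measure_ball_pos _ _ hρ).ne'
  have hbt : b ≠ ∞ := measure_ball_lt_top.ne
  have := (lintegral_mono fun x => volume_ball_mul_enorm_sub_le hEm hρ x).trans
    (hE.lintegral_ball_translate_sub_le hEm hEv ρ)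
  rw [lintegral_const_mul' _ _ hbt, ← hb, mul_comm (ENNReal.ofReal _)] at this
  exact (ENNReal.mul_le_mul_iff_right hb0 hbt).1 this

end Translation

section Compactness

variable {d : ℕ}

/-- Along a subsequence, the intersections with all sets of finite measure have converging
volumes. -/
lemma exists_subseq_tendsto_measureReal_inter (E : ℕ → Set (EuclideanSpace ℝ (Fin d))) :
    ∃ φ : ℕ → ℕ, StrictMono φ ∧ ∀ B : Set (EuclideanSpace ℝ (Fin d)), MeasurableSet B →
      volume B ≠ ∞ → ∃ c, Tendsto (fun n => volume.real (E (φ n) ∩ B)) atTop (𝓝 c) := by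
  let X := Lp ℝ 1 (volume : Measure (EuclideanSpace ℝ (Fin d)))
  let T : ℕ → WeakDual ℝ X := fun n => StrongDual.toWeakDual <| LinearMap.mkContinuous
    { toFun := fun f : X => ∫ x in E n, f x
      map_add' := fun f g => by
        rw [← integral_add (L1.integrable_coeFn f).integrableOn
          (L1.integrable_coeFn g).integrableOn]
        exact integral_congr_ae (ae_restrict_of_ae (Lp.coeFn_add f g))
      map_smul' := fun c f => by
        rw [RingHom.id_apply, ← integral_smul]
        exact integral_congr_ae (ae_restrict_of_ae (Lp.coeFn_smul c f)) } 1 fun f => by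
      rw [one_mul, L1.norm_eq_integral_norm]
      exact (norm_integral_le_integral_norm _).trans (setIntegral_le_integral
        (L1.integrable_coeFn f).norm (Eventually.of_forall fun _ => norm_nonneg _))
  have hp : Fact ((1:ℝ≥0∞) ≠ ∞) := ⟨ENNReal.one_ne_top⟩
  have hT : ∀ n, T n ∈ WeakDual.toStrongDual ⁻¹' closedBall (0 : StrongDual ℝ X) 1 := fun n => by
    rw [mem_preimage, mem_closedBall_zero_iff]
    exact ContinuousLinearMap.opNorm_le_bound _ zero_le_one fun f => by
      rw [one_mul, L1.norm_eq_integral_norm]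
      exact (norm_integral_le_integral_norm _).trans (setIntegral_le_integral
        (L1.integrable_coeFn f).norm (Eventually.of_forall fun _ => norm_nonneg _))
  obtain ⟨T', -, φ, hφ, hlim⟩ := WeakDual.isSeqCompact_closedBall ℝ X 0 1 hT
  refine ⟨φ, hφ, fun B hB hBt => ⟨T' (indicatorConstLp 1 hB hBt 1), ?_⟩⟩
  have := ((WeakDual.eval_continuous (𝕜 := ℝ) (E := X)
    (indicatorConstLp 1 hB hBt 1)).tendsto T').comp hlim
  refine this.congr fun n => ?_
  change ∫ x in E (φ n), indicatorConstLp 1 hB hBt (1:ℝ) x = _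
  rw [← integral_congr_ae (ae_restrict_of_ae indicatorConstLp_coeFn.symm),
    setIntegral_indicator hB]
  simp

lemma exists_isFiniteMeasure_le_volume :
    ∃ μ : Measure (EuclideanSpace ℝ (Fin d)), IsFiniteMeasure μ ∧ μ ≤ volume ∧ volume ≪ μ := by
  set w : EuclideanSpace ℝ (Fin d) → ℝ≥0∞ :=
    fun x => ENNReal.ofReal ((1 + ‖x‖) ^ (-((d:ℝ) + 1))) with hw
  have hwm : Measurable w := by fun_prop
  have hw1 : ∀ x, w x ≤ 1 := fun x => by
    rw [hw, ENNReal.ofReal_le_one]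
    exact Real.rpow_le_one_of_one_le_of_nonpos (by linarith [norm_nonneg x])
      (by have : (0:ℝ) ≤ d := d.cast_nonneg
          linarith)
  refine ⟨volume.withDensity w, ?_, ?_, ?_⟩
  · refine isFiniteMeasure_withDensity ?_
    have := integrable_one_add_norm (E := EuclideanSpace ℝ (Fin d)) (μ := volume)
      (r := (d:ℝ) + 1) (by simp)
    exact this.lintegral_lt_top.ne
  · calc volume.withDensity w ≤ volume.withDensity 1 :=
        withDensity_mono (Eventually.of_forall hw1)
      _ = volume := withDensity_one
  · refine withDensity_absolutelyContinuous' hwm.aemeasurable (Eventually.of_forall fun x => ?_)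
    rw [hw]
    exact (ENNReal.ofReal_pos.2 (Real.rpow_pos_of_pos (by linarith [norm_nonneg x]) _)).ne'

variable {E : ℕ → Set (EuclideanSpace ℝ (Fin d))}

/-- Compactness of sets of uniformly bounded perimeter. -/
lemma exists_subseq_tendsto_indicator (hEm : ∀ n, MeasurableSet (E n))
    (hEv : ∀ n, volume (E n) ≠ ∞) (hE : ∀ n, FinitePerimeter d (E n)) {P : ℝ}
    (hP : ∀ n, perimeter d (E n) ≤ P) :
    ∃ F : Set (EuclideanSpace ℝ (Fin d)), MeasurableSet F ∧ ∃ φ : ℕ → ℕ, StrictMono φ ∧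
      ∀ᵐ x, Tendsto (fun n => (E (φ n)).indicator (fun _ => (1:ℝ)) x) atTop
        (𝓝 (F.indicator (fun _ => (1:ℝ)) x)) := by
  obtain ⟨φ, hφ, hlim⟩ := exists_subseq_tendsto_measureReal_inter E
  obtain ⟨μ, hμ, hμv, hvμ⟩ := exists_isFiniteMeasure_le_volume (d := d)
  set u : ℕ → EuclideanSpace ℝ (Fin d) → ℝ := fun n => (E (φ n)).indicator (fun _ => (1:ℝ))
    with hu
  have hum : ∀ n, Measurable (u n) := fun n => measurable_indicator_one (hEm _)
  have hu1 : ∀ n x, ‖u n x‖ ≤ 1 := fun n x => by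
    by_cases hx : x ∈ E (φ n) <;> simp [hu, hx]
  have hup : ∀ n, MemLp (u n) 1 μ := fun n =>
    MemLp.of_bound (hum n).aestronglyMeasurable 1 (Eventually.of_forall (hu1 n))
  have hcau : CauchySeq fun n => (hup n).toLp := by
    rw [EMetric.cauchySeq_iff]
    intro ε hε
    obtain ⟨η, hη, hηε⟩ : ∃ η : ℝ≥0∞, 0 < η ∧ η + η + (η + η) < ε := by
      obtain ⟨η, hη, h⟩ := ENNReal.exists_pos_mul_lt (a := 4) (b := ε) (by simp) hε.ne'
      exact ⟨η, hη, by convert h using 1; ring⟩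
    obtain ⟨ρ, hρ, hρη⟩ : ∃ ρ : ℝ, 0 < ρ ∧ ENNReal.ofReal (ρ * P) ≤ η := by
      have h1 : Tendsto (fun ρ : ℝ => ENNReal.ofReal (ρ * P)) (𝓝[>] 0) (𝓝 0) := by
        have : Continuous fun ρ : ℝ => ENNReal.ofReal (ρ * P) :=
        ENNReal.continuous_ofReal.comp (by fun_prop)
        simpa using (this.tendsto 0).mono_left nhdsWithin_le_nhds
      obtain ⟨ρ, h2, h3⟩ := ((h1.eventually (eventually_le_nhds hη)).and
        self_mem_nhdsWithin).exists
      exact ⟨ρ, h3, h2⟩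
    set b := volume.real (ball (0 : EuclideanSpace ℝ (Fin d)) ρ) with hb
    have hb0 : 0 < b := ENNReal.toReal_pos (measure_ball_pos _ _ hρ).ne' measure_ball_lt_top.ne
    set a : ℕ → EuclideanSpace ℝ (Fin d) → ℝ :=
      fun n x => volume.real (E (φ n) ∩ ball x ρ) / b with ha
    have ham : ∀ n, Measurable (a n) := fun n => by
      have h1 : ∀ x, volume (E (φ n) ∩ ball x ρ) = ∫⁻ h in ball (0 : EuclideanSpace ℝ (Fin d)) ρ,
        ‖(E (φ n)).indicator (fun _ => (1:ℝ)) (x + h)‖ₑ := fun x =>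
          (setLIntegral_enorm_indicator_add (hEm _) x ρ).symm
      have h2 : Measurable fun x => volume (E (φ n) ∩ ball x ρ) := by
        simp_rw [h1]
        have := hum n
        refine Measurable.lintegral_prod_right' (f := fun p => ‖u n (p.1 + p.2)‖ₑ) ?_
        fun_prop
      exact h2.ennreal_toReal.div_const _
    have hua : ∀ n, ∫⁻ x, ‖u n x - a n x‖ₑ ∂μ ≤ η := fun n =>
      (lintegral_mono' hμv le_rfl).trans <|
        ((hE _).lintegral_indicator_sub_average_le (hEm _) (hEv _) hρ).trans <|
        (ENNReal.ofReal_le_ofReal (mul_le_mul_of_nonneg_left (hP _) hρ.le)).trans hρη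
    have ha1 : ∀ n x, a n x ∈ Icc (0:ℝ) 1 := fun n x => by
      refine ⟨by positivity, div_le_one_of_le₀ ?_ hb0.le⟩
      have : b = volume.real (ball x ρ) := by
        rw [hb, measureReal_def, measureReal_def, Measure.addHaar_ball_center volume x]
      rw [this]
      exact measureReal_mono inter_subset_right measure_ball_lt_top.ne
    have hex : ∀ x, ∃ c, Tendsto (fun n => a n x) atTop (𝓝 c) := fun x => by
      obtain ⟨c, hc⟩ := hlim (ball x ρ) measurableSet_ball measure_ball_lt_top.ne
      exact ⟨c / b, hc.div_const b⟩
    choose a' ha' using hex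
    have ham' : Measurable a' := measurable_of_tendsto_metrizable ham (tendsto_pi_nhds.2 ha')
    have ha1' : ∀ x, a' x ∈ Icc (0:ℝ) 1 := fun x =>
      isClosed_Icc.mem_of_tendsto (ha' x) (Eventually.of_forall fun n => ha1 n x)
    have hdom : Tendsto (fun n => ∫⁻ x, ‖a n x - a' x‖ₑ ∂μ) atTop (𝓝 0) := by
      have h0 : (0:ℝ≥0∞) = ∫⁻ x, (0:ℝ≥0∞) ∂μ := by simp
      rw [h0]
      refine tendsto_lintegral_of_dominated_convergence (fun _ => 1) (fun n => ?_)
        (fun n => Eventually.of_forall fun x => ?_) (by simp)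
        (Eventually.of_forall fun x => ?_)
      · have := ham n
        fun_prop
      · have h1 := ha1 n x
        have h2 := ha1' x
        change ‖a n x - a' x‖ₑ ≤ 1
        rw [← ofReal_norm, ENNReal.ofReal_le_one, Real.norm_eq_abs, abs_le]
        constructor <;> linarith [h1.1, h1.2, h2.1, h2.2]
      · have := ((ha' x).sub_const (a' x)).enorm
        simpa using this
    obtain ⟨N, hN⟩ := eventually_atTop.1 
      (hdom.eventually (eventually_le_nhds hη))
    refine ⟨N, fun m hm n hn => lt_of_le_of_lt ?_ hηε⟩
    rw [Lp.edist_toLp_toLp, eLpNorm_one_eq_lintegral_enorm]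
    have hk : ∀ k, N ≤ k → ∫⁻ x, ‖u k x - a' x‖ₑ ∂μ ≤ η + η := fun k hk => by
      have h1 := hum k
      have h2 := ham k
      calc ∫⁻ x, ‖u k x - a' x‖ₑ ∂μ
          ≤ ∫⁻ x, (‖u k x - a k x‖ₑ + ‖a k x - a' x‖ₑ) ∂μ := by
            refine lintegral_mono fun x => ?_
            rw [← sub_add_sub_cancel (u k x) (a k x) (a' x)]
            exact enorm_add_le _ _
        _ = _ := lintegral_add_left (by fun_prop) _
        _ ≤ _ := add_le_add (hua k) (hN k hk)
    have h1 := hum m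
    calc ∫⁻ x, ‖(u m - u n) x‖ₑ ∂μ
        ≤ ∫⁻ x, (‖u m x - a' x‖ₑ + ‖u n x - a' x‖ₑ) ∂μ := by
          refine lintegral_mono fun x => ?_
          rw [Pi.sub_apply, ← sub_sub_sub_cancel_right (u m x) (u n x) (a' x)]
          exact enorm_sub_le
      _ = _ := lintegral_add_left (by fun_prop) _
      _ ≤ _ := add_le_add (hk m hm) (hk n hn)
  obtain ⟨f, hf⟩ := cauchySeq_tendsto_of_complete hcau
  obtain ⟨ψ, hψ, hae⟩ := (tendstoInMeasure_of_tendsto_Lp hf).exists_seq_tendsto_ae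
  have hfm := Lp.stronglyMeasurable f
  refine ⟨f ⁻¹' {1}, hfm.measurable (measurableSet_singleton 1), φ ∘ ψ, hφ.comp hψ,
    hvμ.ae_le ?_⟩
  have hco : ∀ᵐ x ∂μ, ∀ n, (hup n).toLp (u n) x = u n x := ae_all_iff.2 fun n => (hup n).coeFn_toLp
  filter_upwards [hae, hco] with x hx hc
  simp_rw [hc] at hx
  have h01 : f x ∈ ({0, 1} : Set ℝ) := by
    refine (Set.Finite.isClosed (by simp)).mem_of_tendsto hx (Eventually.of_forall fun n => ?_)
    by_cases hxn : x ∈ E (φ (ψ n)) <;> simp [hu, hxn]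
  have hfx : (f ⁻¹' {1}).indicator (fun _ => (1:ℝ)) x = f x := by
    rcases h01 with h | h
    · have : x ∉ f ⁻¹' {1} := by simp [h]
      rw [indicator_of_notMem this, h]
    · rw [mem_singleton_iff] at h
      have : x ∈ f ⁻¹' {1} := by simp [h]
      rw [indicator_of_mem this, h]
  rw [hfx]
  exact hx

end Compactness

section Limits

variable {α : Type*} [MeasurableSpace α] {μ : Measure α} {E : ℕ → Set α} {F : Set α}

lemma tendsto_setIntegral_of_tendsto_indicator (hE : ∀ n, MeasurableSet (E n))
    (hF : MeasurableSet F)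
    (h : ∀ᵐ x ∂μ, Tendsto (fun n => (E n).indicator (fun _ => (1:ℝ)) x) atTop
      (𝓝 (F.indicator (fun _ => (1:ℝ)) x))) {f : α → ℝ} (hf : Integrable f μ) :
    Tendsto (fun n => ∫ x in E n, f x ∂μ) atTop (𝓝 (∫ x in F, f x ∂μ)) := by
  have e : ∀ (S : Set α) x, S.indicator f x = S.indicator (fun _ => (1:ℝ)) x * f x :=
    fun S x => by by_cases hx : x ∈ S <;> simp [hx]
  simp_rw [← integral_indicator (hE _), ← integral_indicator hF]
  refine tendsto_integral_of_dominated_convergence (fun x => ‖f x‖)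
    (fun n => hf.aestronglyMeasurable.indicator (hE n)) hf.norm
    (fun n => Eventually.of_forall fun x => norm_indicator_le_norm_self _ _) ?_
  filter_upwards [h] with x hx
  simp_rw [e]
  exact hx.mul_const _

lemma measure_le_liminf_of_tendsto_indicator (hE : ∀ n, MeasurableSet (E n))
    (hF : MeasurableSet F)
    (h : ∀ᵐ x ∂μ, Tendsto (fun n => (E n).indicator (fun _ => (1:ℝ)) x) atTop
      (𝓝 (F.indicator (fun _ => (1:ℝ)) x))) :
    μ F ≤ liminf (fun n => μ (E n)) atTop := by
  have e : ∀ (S : Set α) x, S.indicator (fun _ => (1:ℝ≥0∞)) x =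
      ENNReal.ofReal (S.indicator (fun _ => (1:ℝ)) x) :=
    fun S x => by by_cases hx : x ∈ S <;> simp [hx]
  simp_rw [← lintegral_indicator_one (hE _), ← lintegral_indicator_one hF]
  refine le_trans (lintegral_mono_ae ?_)
    (lintegral_liminf_le fun n => measurable_const.indicator (hE n))
  filter_upwards [h] with x hx
  have := (ENNReal.continuous_ofReal.tendsto _).comp hx
  refine le_of_eq (Eq.trans ?_ (this.liminf_eq.symm.trans ?_))
  · exact e F x
  · exact congrArg (liminf · atTop) (funext fun n => (e (E n) x).symm)

end Limits

section Coulomb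

/-- The Coulomb interaction as a measure on pairs. -/
def coulombMeasure : Measure (E3 × E3) :=
  (volume.prod volume).withDensity fun p => ENNReal.ofReal ‖p.1 - p.2‖⁻¹

variable {S T : Set E3}

lemma coulombMeasure_absolutelyContinuous : coulombMeasure ≪ volume.prod volume :=
  withDensity_absolutelyContinuous _ _

lemma coulombMeasure_prod (hS : MeasurableSet S) (hT : MeasurableSet T) :
    coulombMeasure (S ×ˢ T) = ∫⁻ x in S, ∫⁻ y in T, ENNReal.ofReal ‖x - y‖⁻¹ := by
  rw [coulombMeasure, withDensity_apply _ (hS.prod hT), ← Measure.prod_restrict,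
    lintegral_prod _ (Measurable.aemeasurable (by fun_prop))]

lemma lintegral_ball_inv_norm_lt_top :
    ∫⁻ y in ball (0 : E3) 1, ENNReal.ofReal ‖y‖⁻¹ < ∞ := by
  have h1 : Integrable fun y : E3 => (Ioo (0:ℝ) 1).indicator (fun r => r⁻¹) ‖y‖ := by
    rw [integrable_fun_norm_addHaar]
    have h2 : IntegrableOn (fun r : ℝ => (Ioo (0:ℝ) 1).indicator (fun r => r) r) (Ioi 0) := by
      refine Integrable.integrableOn ?_
      rw [integrable_indicator_iff measurableSet_Ioo]
      exact (continuous_id.integrableOn_Icc).mono_set Ioo_subset_Icc_self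
    refine h2.congr_fun (fun r hr => ?_) measurableSet_Ioi
    by_cases hr1 : r ∈ Ioo (0:ℝ) 1
    · have : r ≠ 0 := (mem_Ioi.1 hr).ne'
      simp [hr1]
      field_simp
    · simp [hr1]
  refine lt_of_le_of_lt ?_ h1.lintegral_lt_top
  rw [← lintegral_indicator measurableSet_ball]
  refine lintegral_mono fun y => ?_
  by_cases hy : y ∈ ball (0 : E3) 1
  · rw [indicator_of_mem hy]
    rcases eq_or_ne y 0 with rfl | h0
    · simp
    · have : ‖y‖ ∈ Ioo (0:ℝ) 1 := ⟨norm_pos_iff.2 h0, mem_ball_zero_iff.1 hy⟩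
      rw [indicator_of_mem this]
  · simp [hy]

lemma setLIntegral_inv_norm_sub_le (hT : MeasurableSet T) (x : E3) :
    ∫⁻ y in T, ENNReal.ofReal ‖x - y‖⁻¹ ≤
      (∫⁻ y in ball (0 : E3) 1, ENNReal.ofReal ‖y‖⁻¹) + volume T := by
  have h1 : ∫⁻ y in ball x 1, ENNReal.ofReal ‖x - y‖⁻¹ =
      ∫⁻ y in ball (0 : E3) 1, ENNReal.ofReal ‖y‖⁻¹ := by
    rw [← (measurePreserving_add_left volume x).setLIntegral_comp_preimage measurableSet_ball
      (by fun_prop)]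
    simp
  rw [← h1, ← lintegral_inter_add_sdiff _ T measurableSet_ball (B := ball x 1)]
  refine add_le_add (lintegral_mono_set inter_subset_right) ?_
  calc ∫⁻ y in T \ ball x 1, ENNReal.ofReal ‖x - y‖⁻¹ ≤ ∫⁻ y in T \ ball x 1, 1 := by
        refine setLIntegral_mono' (hT.diff measurableSet_ball) fun y hy => ?_
        have : 1 ≤ ‖x - y‖ := by
          have := hy.2
          rwa [mem_ball', not_lt, dist_eq_norm] at this
        rw [ENNReal.ofReal_le_one]
        exact inv_le_one_of_one_le₀ this
    _ ≤ volume T := by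
        rw [setLIntegral_one]
        exact measure_mono sdiff_subset

lemma coulombMeasure_prod_lt_top (hS : MeasurableSet S) (hT : MeasurableSet T)
    (hSv : volume S ≠ ∞) (hTv : volume T ≠ ∞) : coulombMeasure (S ×ˢ T) < ∞ := by
  rw [coulombMeasure_prod hS hT]
  refine lt_of_le_of_lt (lintegral_mono fun x => setLIntegral_inv_norm_sub_le hT x) ?_
  rw [setLIntegral_const]
  exact ENNReal.mul_lt_top (ENNReal.add_lt_top.2 ⟨lintegral_ball_inv_norm_lt_top, hTv.lt_top⟩)
    hSv.lt_top

lemma coulomb_eq (hS : MeasurableSet S) (hSv : volume S ≠ ∞) :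
    coulomb S = 1 / 2 * coulombMeasure.real (S ×ˢ S) := by
  have h1 : ∀ x, ∫ y in S, ‖x - y‖⁻¹ = (∫⁻ y in S, ENNReal.ofReal ‖x - y‖⁻¹).toReal := fun x =>
    integral_eq_lintegral_of_nonneg_ae (Eventually.of_forall fun y => by positivity)
      (Measurable.aestronglyMeasurable (by fun_prop))
  have hm : Measurable fun x : E3 => ∫⁻ y in S, ENNReal.ofReal ‖x - y‖⁻¹ :=
    Measurable.lintegral_prod_right' (f := fun p : E3 × E3 => ENNReal.ofReal ‖p.1 - p.2‖⁻¹)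
      (by fun_prop)
  rw [coulomb, measureReal_def, coulombMeasure_prod hS hS]
  simp_rw [h1]
  rw [integral_toReal hm.aemeasurable (Eventually.of_forall fun x =>
    (setLIntegral_inv_norm_sub_le hS x).trans_lt
      (ENNReal.add_lt_top.2 ⟨lintegral_ball_inv_norm_lt_top, hSv.lt_top⟩))]

lemma coulomb_nonneg : 0 ≤ coulomb S :=
  mul_nonneg (by norm_num) (integral_nonneg fun _ => integral_nonneg fun _ => by positivity)

lemma coulomb_preimage_add_right (a : E3) : coulomb ((· + a) ⁻¹' S) = coulomb S := by
  have h1 : ∀ f : E3 → ℝ, ∫ x in (· + a) ⁻¹' S, f (x + a) = ∫ x in S, f x := fun f =>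
    (measurePreserving_add_right volume a).setIntegral_preimage_emb
      (measurableEmbedding_addRight a) f S
  rw [coulomb, coulomb, ← h1 fun x => ∫ y in S, ‖x - y‖⁻¹]
  congr 2 with x
  rw [← h1 fun y => ‖x + a - y‖⁻¹]
  simp

/-- The mutual Coulomb energy of two sets. -/
def mutualCoulomb (S T : Set E3) : ℝ :=
  1 / 2 * (coulombMeasure.real (S ×ˢ T) + coulombMeasure.real (T ×ˢ S))

lemma mutualCoulomb_nonneg : 0 ≤ mutualCoulomb S T := by unfold mutualCoulomb; positivity

lemma coulomb_union (hS : MeasurableSet S) (hT : MeasurableSet T) (hSv : volume S ≠ ∞)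
    (hTv : volume T ≠ ∞) (hST : Disjoint S T) :
    coulomb (S ∪ T) = coulomb S + coulomb T + mutualCoulomb S T := by
  have hf : ∀ {A B : Set E3}, MeasurableSet A → MeasurableSet B → volume A ≠ ∞ → volume B ≠ ∞ →
    coulombMeasure (A ×ˢ B) ≠ ∞ := fun hA hB hAv hBv =>
      (coulombMeasure_prod_lt_top hA hB hAv hBv).ne
  have hU : volume (S ∪ T) ≠ ∞ := measure_union_ne_top hSv hTv
  have hUm := hS.union hT
  rw [coulomb_eq hUm hU, coulomb_eq hS hSv, coulomb_eq hT hTv, mutualCoulomb, union_prod,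
    measureReal_union (hST.set_prod_left _ _) (hT.prod hUm) (hf hS hUm hSv hU) (hf hT hUm hTv hU),
    prod_union, prod_union,
    measureReal_union (hST.set_prod_right _ _) (hS.prod hT) (hf hS hS hSv hSv)
      (hf hS hT hSv hTv),
    measureReal_union (hST.set_prod_right _ _) (hT.prod hT) (hf hT hS hTv hSv)
      (hf hT hT hTv hTv)]
  ring

/-- Lower semicontinuity of the Coulomb energy. -/
lemma eventually_coulomb_sub_le {E : ℕ → Set E3} {F : Set E3} (hE : ∀ n, MeasurableSet (E n))
    (hEv : ∀ n, volume (E n) ≠ ∞) (hF : MeasurableSet F) (hFv : volume F ≠ ∞)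
    (h : ∀ᵐ x, Tendsto (fun n => (E n).indicator (fun _ => (1:ℝ)) x) atTop
      (𝓝 (F.indicator (fun _ => (1:ℝ)) x))) {η : ℝ} (hη : 0 < η) :
    ∀ᶠ n in atTop, coulomb F - η ≤ coulomb (E n) := by
  have e : ∀ (S : Set E3) (p : E3 × E3), (S ×ˢ S).indicator (fun _ => (1:ℝ)) p =
      S.indicator (fun _ => (1:ℝ)) p.1 * S.indicator (fun _ => (1:ℝ)) p.2 := fun S p => by
    by_cases h1 : p.1 ∈ S <;> by_cases h2 : p.2 ∈ S <;> simp [indicator, h1, h2]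
  have h2 : ∀ᵐ p ∂coulombMeasure,
      Tendsto (fun n => (E n ×ˢ E n).indicator (fun _ => (1:ℝ)) p) atTop
      (𝓝 ((F ×ˢ F).indicator (fun _ => (1:ℝ)) p)) := by
    refine coulombMeasure_absolutelyContinuous.ae_le ?_
    filter_upwards [Measure.quasiMeasurePreserving_fst.ae h,
      Measure.quasiMeasurePreserving_snd.ae h] with p h3 h4
    simp_rw [e]
    exact h3.mul h4
  have h3 := measure_le_liminf_of_tendsto_indicator (fun n => (hE n).prod (hE n)) (hF.prod hF) h2
  by_cases h0 : coulomb F - η < 0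
  · exact Eventually.of_forall fun n => h0.le.trans coulomb_nonneg
  have hlt : ENNReal.ofReal (2 * (coulomb F - η)) <
      liminf (fun n => coulombMeasure (E n ×ˢ E n)) atTop := by
    refine lt_of_lt_of_le ?_ h3
    rw [← ofReal_measureReal (coulombMeasure_prod_lt_top hF hF hFv hFv).ne,
      ENNReal.ofReal_lt_ofReal_iff_of_nonneg (by linarith)]
    have := coulomb_eq hF hFv
    linarith
  filter_upwards [eventually_lt_of_lt_liminf hlt] with n hn
  rw [← ofReal_measureReal (coulombMeasure_prod_lt_top (hE n) (hE n) (hEv n) (hEv n)).ne,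
    ENNReal.ofReal_lt_ofReal_iff_of_nonneg (by linarith)] at hn
  have := coulomb_eq (hE n) (hEv n)
  linarith

/-- Lower semicontinuity of the liquid drop energy. -/
lemma ldEnergy_le_of_tendsto {E : ℕ → Set E3} {F : Set E3} (hE : ∀ n, MeasurableSet (E n))
    (hEv : ∀ n, volume (E n) ≠ ∞) (hEP : ∀ n, FinitePerimeter 3 (E n)) (hF : MeasurableSet F)
    (hFv : volume F ≠ ∞)
    (h : ∀ᵐ x, Tendsto (fun n => (E n).indicator (fun _ => (1:ℝ)) x) atTop
      (𝓝 (F.indicator (fun _ => (1:ℝ)) x))) {c : ℕ → ℝ} {c₀ : ℝ}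
    (hc : ∀ n, ldEnergy (E n) ≤ c n) (hc₀ : Tendsto c atTop (𝓝 c₀)) :
    FinitePerimeter 3 F ∧ ldEnergy F ≤ c₀ := by
  have key : ∀ X, IsTestField X → ∫ x in F, divg X x ≤ c₀ - coulomb F := fun X hX => by
    refine le_of_forall_pos_le_add fun η hη => ?_
    have h1 := tendsto_setIntegral_of_tendsto_indicator hE hF h hX.integrable_divg
    refine le_of_tendsto_of_tendsto h1 ((hc₀.sub_const (coulomb F)).add_const η) ?_
    filter_upwards [eventually_coulomb_sub_le hE hEv hF hFv h hη] with n hn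
    have h2 := (hEP n).setIntegral_divg_le hX
    have h3 := hc n
    rw [ldEnergy] at h3
    linarith
  obtain ⟨h1, h2⟩ := perimeter_le_of_forall key
  exact ⟨h1, by rw [ldEnergy]; linarith⟩

end Coulomb

section SoftNorm

variable {d : ℕ}

/-- A smooth substitute for the norm. -/
def softNorm (x : EuclideanSpace ℝ (Fin d)) : ℝ := √(1 + ‖x‖ ^ 2)

lemma norm_le_softNorm (x : EuclideanSpace ℝ (Fin d)) : ‖x‖ ≤ softNorm x :=
  Real.le_sqrt_of_sq_le (by linarith)

lemma softNorm_le (x : EuclideanSpace ℝ (Fin d)) : softNorm x ≤ 1 + ‖x‖ := by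
  rw [softNorm, Real.sqrt_le_left (by positivity)]
  nlinarith [norm_nonneg x]

lemma contDiff_softNorm : ContDiff ℝ 1 (softNorm (d := d)) :=
  (contDiff_const.add (contDiff_norm_sq ℝ)).sqrt fun x => by positivity

lemma norm_fderiv_softNorm_le (x : EuclideanSpace ℝ (Fin d)) :
    ‖fderiv ℝ softNorm x‖ ≤ 1 := by
  have h : ∀ x y : EuclideanSpace ℝ (Fin d), softNorm x ≤ softNorm y + ‖x - y‖ := fun x y => by
    have hy := norm_le_softNorm y
    have h1 : ‖x‖ ≤ ‖y‖ + ‖x - y‖ := norm_le_insert' x y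
    have h2 : softNorm y ^ 2 = 1 + ‖y‖ ^ 2 := Real.sq_sqrt (by positivity)
    have h3 : 0 ≤ softNorm y := Real.sqrt_nonneg _
    rw [softNorm, Real.sqrt_le_left (by positivity)]
    nlinarith [norm_nonneg x, norm_nonneg y, norm_nonneg (x - y)]
  refine norm_fderiv_le_of_lipschitz ℝ (C := 1) (LipschitzWith.of_dist_le_mul fun x y => ?_)
  rw [NNReal.coe_one, one_mul, Real.dist_eq, dist_eq_norm, abs_le]
  have h1 := h x y
  have h2 := h y x
  rw [norm_sub_rev] at h2
  constructor <;> linarith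

lemma measurable_softNorm : Measurable (softNorm (d := d)) :=
  contDiff_softNorm.continuous.measurable

lemma setOf_softNorm_lt_subset_ball (t : ℝ) :
    {x : EuclideanSpace ℝ (Fin d) | softNorm x < t} ⊆ ball 0 t := fun x hx =>
  mem_ball_zero_iff.2 ((norm_le_softNorm x).trans_lt hx)

lemma ball_subset_setOf_softNorm_lt (t : ℝ) :
    ball 0 (t - 1) ⊆ {x : EuclideanSpace ℝ (Fin d) | softNorm x < t} := fun x hx => by
  have := mem_ball_zero_iff.1 hx
  exact (softNorm_le x).trans_lt (by linarith)

end SoftNorm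

lemma exists_finitePerimeter_volume_eq {d : ℕ} [NeZero d] {A : ℝ} (hA : 0 < A) :
    ∃ Ω : Set (EuclideanSpace ℝ (Fin d)), MeasurableSet Ω ∧ FinitePerimeter d Ω ∧
      volume Ω = ENNReal.ofReal A := by
  have hae := ae_eventually_volume_inter_preimage_closedBall_le
    (E := ball (0 : EuclideanSpace ℝ (Fin d)) 2) measure_ball_lt_top.ne measurable_softNorm
  obtain ⟨t, ⟨-, ht⟩, ht1, ht2⟩ := (Measure.dense_of_ae hae).exists_mem_open isOpen_Ioo
    (nonempty_Ioo.2 one_lt_two)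
  set S := {x : EuclideanSpace ℝ (Fin d) | softNorm x < t} with hS
  have hSm : MeasurableSet S := measurable_softNorm measurableSet_Iio
  have hSP : FinitePerimeter d S := by
    have h := ht _ (lt_add_one _)
    have h0 : (0:ℝ) ≤ (sliceDensity (ball (0 : EuclideanSpace ℝ (Fin d)) 2) softNorm t).toReal :=
      ENNReal.toReal_nonneg
    have hA' : ∀ᶠ δ in 𝓝[>] 0, volume (univ ∩ softNorm (d := d) ⁻¹' closedBall t δ) ≤
        ENNReal.ofReal (2 * ((sliceDensity (ball (0 : EuclideanSpace ℝ (Fin d)) 2)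
          softNorm t).toReal + 1) * δ) := by
      filter_upwards [h, Ioo_mem_nhdsGT (sub_pos.2 ht2)] with δ h1 h2
      refine (measure_mono ?_).trans h1
      rintro x ⟨-, hx⟩
      refine ⟨?_, hx⟩
      have h3 : |softNorm x - t| ≤ δ := hx
      have := (abs_le.1 h3).2
      exact setOf_softNorm_lt_subset_ball 2 (by rw [mem_ofPred_eq]; linarith [h2.2])
    have h2 := (finitePerimeter_univ.cut MeasurableSet.univ contDiff_softNorm
      norm_fderiv_softNorm_le (by positivity) hA').1
    rwa [univ_inter] at h2
  have hv0 : volume S ≠ 0 :=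
    (measure_pos_of_superset (ball_subset_setOf_softNorm_lt t)
      (measure_ball_pos _ _ (sub_pos.2 ht1)).ne').ne'
  have hvt : volume S ≠ ∞ :=
    ((measure_mono (setOf_softNorm_lt_subset_ball t)).trans_lt measure_ball_lt_top).ne
  have hv : 0 < volume.real S := ENNReal.toReal_pos hv0 hvt
  set c : ℝ := (A / volume.real S) ^ ((d:ℝ)⁻¹) with hc
  have hc0 : 0 < c := by positivity
  refine ⟨c • S, hSm.const_smul₀ c, hSP.smul hc0, ?_⟩
  have hcd : c ^ d = A / volume.real S := by
    rw [hc, Real.rpow_inv_natCast_pow (by positivity) (NeZero.ne d)]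
  rw [Measure.addHaar_smul, finrank_euclideanSpace_fin, abs_of_pos (by positivity), hcd,
    ← ofReal_measureReal hvt, ← ENNReal.ofReal_mul (by positivity), div_mul_cancel₀ _ hv.ne']

section Volume

instance : SFinite coulombMeasure := by unfold coulombMeasure; infer_instance

/-- Competitors of the liquid drop problem. -/
structure IsDrop (Ω : Set E3) : Prop where
  measurableSet : MeasurableSet Ω
  finitePerimeter : FinitePerimeter 3 Ω
  volume_ne_top : volume Ω ≠ ∞

variable {Ω S T : Set E3}

lemma ldEnergy_nonneg : 0 ≤ ldEnergy Ω := add_nonneg perimeter_nonneg coulomb_nonneg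

lemma ofReal_mutualCoulomb (hS : MeasurableSet S) (hT : MeasurableSet T) (hSv : volume S ≠ ∞)
    (hTv : volume T ≠ ∞) : coulombMeasure (S ×ˢ T) + coulombMeasure (T ×ˢ S) =
      ENNReal.ofReal (2 * mutualCoulomb S T) := by
  rw [← ofReal_measureReal (coulombMeasure_prod_lt_top hS hT hSv hTv).ne,
    ← ofReal_measureReal (coulombMeasure_prod_lt_top hT hS hTv hSv).ne,
    ← ENNReal.ofReal_add measureReal_nonneg measureReal_nonneg, mutualCoulomb]
  congr 1
  ring

lemma norm_le_sum_abs (v : E3) : ‖v‖ ≤ ∑ i, |v i| := by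
  rw [EuclideanSpace.norm_eq, Real.sqrt_le_left (by positivity), Fin.sum_univ_three,
    Fin.sum_univ_three]
  simp only [Real.norm_eq_abs]
  nlinarith [mul_nonneg (abs_nonneg (v 0)) (abs_nonneg (v 1)),
    mul_nonneg (abs_nonneg (v 0)) (abs_nonneg (v 2)),
    mul_nonneg (abs_nonneg (v 1)) (abs_nonneg (v 2))]

lemma sq_volume_le_setLIntegral_coulombMeasure (hΩ : MeasurableSet Ω) :
    volume Ω * volume Ω ≤ ∫⁻ p in Ω ×ˢ Ω, ENNReal.ofReal ‖p.1 - p.2‖ ∂coulombMeasure := by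
  rw [coulombMeasure, setLIntegral_withDensity_eq_setLIntegral_mul _ (by fun_prop) (by fun_prop)
    (hΩ.prod hΩ), ← Measure.prod_restrict, lintegral_prod _ (Measurable.aemeasurable (by fun_prop))]
  refine le_of_eq ?_
  have : ∀ x : E3, ∫⁻ y in Ω, ((fun p : E3 × E3 => ENNReal.ofReal ‖p.1 - p.2‖⁻¹) *
      fun p : E3 × E3 => ENNReal.ofReal ‖p.1 - p.2‖) (x, y) = volume Ω := fun x => by
    rw [← setLIntegral_one]
    refine lintegral_congr_ae (ae_restrict_of_ae ?_)
    filter_upwards [compl_mem_ae_iff.2 (measure_singleton x)] with y hy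
    have : ‖x - y‖ ≠ 0 := norm_ne_zero_iff.2 (sub_ne_zero.2 fun h => hy h.symm)
    rw [Pi.mul_apply, ← ENNReal.ofReal_mul (by positivity), inv_mul_cancel₀ this,
      ENNReal.ofReal_one]
  simp_rw [this]
  rw [setLIntegral_const]

/-- The separation of pairs by parallel hyperplanes measures their distance. -/
lemma setLIntegral_abs_sub_le (hΩ : MeasurableSet Ω) {R : ℝ} (hR : Ω ⊆ ball 0 R) (i : Fin 3) :
    ∫⁻ p in Ω ×ˢ Ω, ENNReal.ofReal |(p.1 - p.2) i| ∂coulombMeasure ≤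
      ∫⁻ t in Ioo (-R) R, (coulombMeasure ((Ω ∩ {x | x i < t}) ×ˢ (Ω ∩ {x | t ≤ x i})) +
        coulombMeasure ((Ω ∩ {x | t ≤ x i}) ×ˢ (Ω ∩ {x | x i < t}))) := by
  set U : Set (ℝ × (E3 × E3)) :=
    (Prod.snd ⁻¹' Ω ×ˢ Ω) ∩
      ({q | min (q.2.1 i) (q.2.2 i) < q.1} ∩ {q | q.1 ≤ max (q.2.1 i) (q.2.2 i)}) with hU
  have hUm : MeasurableSet U := by
    refine (measurable_snd (hΩ.prod hΩ)).inter
      ((measurableSet_lt ?_ ?_).inter (measurableSet_le ?_ ?_)) <;> fun_prop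
  have h1 : ∀ p ∈ Ω ×ˢ Ω, ENNReal.ofReal |(p.1 - p.2) i| ≤
      ∫⁻ t in Ioo (-R) R, U.indicator 1 (t, p) := fun p hp => by
    have hR' : ∀ x ∈ Ω, -R < x i ∧ x i < R := fun x hx =>
      abs_lt.1 ((PiLp.norm_apply_le x i).trans_lt (mem_ball_zero_iff.1 (hR hx)))
    have h2 : Ioc (min (p.1 i) (p.2 i)) (max (p.1 i) (p.2 i)) ⊆ Ioo (-R) R := fun t ht =>
      ⟨(lt_min (hR' _ hp.1).1 (hR' _ hp.2).1).trans ht.1,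
        ht.2.trans_lt (max_lt (hR' _ hp.1).2 (hR' _ hp.2).2)⟩
    calc ENNReal.ofReal |(p.1 - p.2) i|
        = volume (Ioc (min (p.1 i) (p.2 i)) (max (p.1 i) (p.2 i))) := by
          rw [Real.volume_Ioc, max_sub_min_eq_abs', PiLp.sub_apply]
      _ = ∫⁻ t in Ioc (min (p.1 i) (p.2 i)) (max (p.1 i) (p.2 i)), 1 := by simp
      _ ≤ ∫⁻ t in Ioc (min (p.1 i) (p.2 i)) (max (p.1 i) (p.2 i)), U.indicator 1 (t, p) := by
          refine setLIntegral_mono' measurableSet_Ioc fun t ht => ?_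
          have : (t, p) ∈ U := ⟨hp, ht.1, ht.2⟩
          rw [indicator_of_mem this, Pi.one_apply]
      _ ≤ _ := lintegral_mono_set h2
  calc ∫⁻ p in Ω ×ˢ Ω, ENNReal.ofReal |(p.1 - p.2) i| ∂coulombMeasure
      ≤ ∫⁻ p in Ω ×ˢ Ω, (∫⁻ t in Ioo (-R) R, U.indicator 1 (t, p)) ∂coulombMeasure :=
        setLIntegral_mono' (hΩ.prod hΩ) h1
    _ ≤ ∫⁻ p, (∫⁻ t in Ioo (-R) R, U.indicator 1 (t, p)) ∂coulombMeasure :=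
        setLIntegral_le_lintegral _ _
    _ = ∫⁻ t in Ioo (-R) R, ∫⁻ p, U.indicator 1 (t, p) ∂coulombMeasure :=
        lintegral_lintegral_swap
          ((measurable_one.indicator hUm).comp measurable_swap).aemeasurable
    _ ≤ _ := by
        refine lintegral_mono fun t => ?_
        have h3 : ∀ p, U.indicator (1 : ℝ × (E3 × E3) → ℝ≥0∞) (t, p) =
          (Prod.mk t ⁻¹' U).indicator 1 p := fun p => rfl
        simp_rw [h3]
        rw [lintegral_indicator_one (measurable_prodMk_left hUm)]
        refine le_trans (measure_mono ?_) (measure_union_le _ _)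
        rintro p ⟨⟨hp1, hp2⟩, h4, h5⟩
        change min (p.1 i) (p.2 i) < t at h4
        change t ≤ max (p.1 i) (p.2 i) at h5
        rcases min_lt_iff.1 h4 with h6 | h6 <;> rcases le_max_iff.1 h5 with h7 | h7
        · exact absurd h6 (not_lt.2 h7)
        · exact Or.inl ⟨⟨hp1, h6⟩, hp2, h7⟩
        · exact Or.inr ⟨⟨hp1, h7⟩, hp2, h6⟩
        · exact absurd h6 (not_lt.2 h7)

lemma contDiff_coord (i : Fin 3) : ContDiff ℝ 1 fun x : E3 => x i := by fun_prop

lemma norm_fderiv_coord_le (i : Fin 3) (x : E3) : ‖fderiv ℝ (fun x : E3 => x i) x‖ ≤ 1 := by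
  refine norm_fderiv_le_of_lipschitz ℝ (C := 1) (LipschitzWith.of_dist_le_mul fun x y => ?_)
  rw [NNReal.coe_one, one_mul, dist_eq_norm, dist_eq_norm, ← PiLp.sub_apply]
  exact PiLp.norm_apply_le _ i

/-- Splitting a near-minimizer along hyperplanes bounds its volume. -/
lemma IsDrop.volume_le (hΩ : IsDrop Ω) {R μ : ℝ} (hR0 : 0 < R) (hR : Ω ⊆ ball 0 R)
    (hμ : ∀ S ⊆ Ω, IsDrop S → μ * volume.real S ≤ ldEnergy S)
    (hle : ldEnergy Ω ≤ (μ + 1 / R) * volume.real Ω) :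
    volume Ω ≤ ENNReal.ofReal (12 + 24 * stepBound) := by
  obtain ⟨hm, hP, hv⟩ := hΩ
  have hK := stepBound_nonneg
  have hcut : ∀ i : Fin 3, ∀ᵐ t : ℝ,
      coulombMeasure ((Ω ∩ {x | x i < t}) ×ˢ (Ω ∩ {x | t ≤ x i})) +
        coulombMeasure ((Ω ∩ {x | t ≤ x i}) ×ˢ (Ω ∩ {x | x i < t})) ≤
      ENNReal.ofReal (2 * (volume.real Ω / R)) +
        ENNReal.ofReal (8 * stepBound) * sliceDensity Ω (fun x : E3 => x i) t := fun i => by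
    filter_upwards [ae_cut hm hP hv (contDiff_coord i) (norm_fderiv_coord_le i)]
      with t ⟨hfin, hSP, hTP, hPle⟩
    set S := Ω ∩ {x : E3 | x i < t}
    set T := Ω ∩ {x : E3 | t ≤ x i}
    have hgm : Measurable fun x : E3 => x i := (contDiff_coord i).continuous.measurable
    have hSm : MeasurableSet S := hm.inter (hgm measurableSet_Iio)
    have hTm : MeasurableSet T := hm.inter (hgm measurableSet_Ici)
    have hSv : volume S ≠ ∞ := measure_ne_top_of_subset inter_subset_left hv
    have hTv : volume T ≠ ∞ := measure_ne_top_of_subset inter_subset_left hv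
    have hST : Disjoint S T := disjoint_left.2 fun x hx hx' =>
      not_lt.2 (show t ≤ x i from hx'.2) hx.2
    have hun : S ∪ T = Ω := by
      ext x
      simp only [S, T, mem_union, mem_inter_iff, mem_ofPred_eq, ← and_or_left]
      simp [lt_or_ge]
    have h1 := coulomb_union hSm hTm hSv hTv hST
    have h2 := measureReal_union hST hTm hSv hTv
    rw [hun] at h1 h2
    have h3 := hμ S inter_subset_left ⟨hSm, hSP, hSv⟩
    have h4 := hμ T inter_subset_left ⟨hTm, hTP, hTv⟩
    rw [ofReal_mutualCoulomb hSm hTm hSv hTv, ← ENNReal.ofReal_toReal hfin.ne,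
      ← ENNReal.ofReal_mul (by positivity), ← ENNReal.ofReal_add (by positivity) (by positivity)]
    refine ENNReal.ofReal_le_ofReal ?_
    simp only [ldEnergy] at h3 h4 hle
    have h5 : (μ + 1 / R) * volume.real Ω =
      μ * volume.real S + μ * volume.real T + volume.real Ω / R := by
        conv_rhs => rw [← mul_add, ← h2]
        ring
    linarith
  have hcoord : ∀ i : Fin 3, ∫⁻ p in Ω ×ˢ Ω, ENNReal.ofReal |(p.1 - p.2) i| ∂coulombMeasure ≤
      ENNReal.ofReal (4 + 8 * stepBound) * volume Ω := fun i => by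
    refine (setLIntegral_abs_sub_le hm hR i).trans
      ((lintegral_mono_ae (ae_restrict_of_ae (hcut i))).trans ?_)
    rw [lintegral_add_left measurable_const, setLIntegral_const,
      lintegral_const_mul' _ _ ENNReal.ofReal_ne_top]
    refine (add_le_add_right (mul_le_mul_right (setLIntegral_sliceDensity_le
      (contDiff_coord i).continuous.measurable _) _) _).trans_eq ?_
    rw [Real.volume_Ioo, ← ENNReal.ofReal_mul (by positivity),
      ENNReal.ofReal_add (by norm_num) (by positivity), add_mul]
    congr 1
    rw [← ofReal_measureReal hv, ← ENNReal.ofReal_mul (by norm_num)]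
    congr 1
    field_simp
    ring
  have hsq : volume Ω * volume Ω ≤ ENNReal.ofReal (12 + 24 * stepBound) * volume Ω := by
    calc volume Ω * volume Ω
        ≤ ∫⁻ p in Ω ×ˢ Ω, ENNReal.ofReal ‖p.1 - p.2‖ ∂coulombMeasure :=
          sq_volume_le_setLIntegral_coulombMeasure hm
      _ ≤ ∫⁻ p in Ω ×ˢ Ω, ∑ i, ENNReal.ofReal |(p.1 - p.2) i| ∂coulombMeasure := by
          refine lintegral_mono fun p => ?_
          rw [← ENNReal.ofReal_sum_of_nonneg fun i _ => abs_nonneg _]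
          exact ENNReal.ofReal_le_ofReal (norm_le_sum_abs _)
      _ = ∑ i, ∫⁻ p in Ω ×ˢ Ω, ENNReal.ofReal |(p.1 - p.2) i| ∂coulombMeasure :=
          lintegral_finsetSum _ fun i _ => by fun_prop
      _ ≤ ∑ _i : Fin 3, ENNReal.ofReal (4 + 8 * stepBound) * volume Ω :=
          Finset.sum_le_sum fun i _ => hcoord i
      _ = ENNReal.ofReal (12 + 24 * stepBound) * volume Ω := by
          rw [Finset.sum_const, Finset.card_univ, Fintype.card_fin, ← smul_mul_assoc,
            ← ENNReal.ofReal_nsmul]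
          congr 2
          simp only [nsmul_eq_mul]
          push_cast
          ring
  rcases eq_or_ne (volume Ω) 0 with h0 | h0
  · simp [h0]
  · exact (ENNReal.mul_le_mul_iff_left h0 hv).1 hsq

end Volume

section NearMinimizers

variable {Ω S B : Set E3}

/-- The infimal energy per volume among competitors contained in `B`. -/
def infRatio (B : Set E3) : ℝ :=
  sInf {r | ∃ Ω, IsDrop Ω ∧ Ω ⊆ B ∧ 0 < volume Ω ∧ r = ldRatio Ω}

lemma infRatio_nonneg : 0 ≤ infRatio B := by
  refine Real.sInf_nonneg ?_
  rintro r ⟨Ω, -, -, -, rfl⟩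
  exact div_nonneg ldEnergy_nonneg ENNReal.toReal_nonneg

lemma infRatio_le (hΩ : IsDrop Ω) (hB : Ω ⊆ B) (h0 : 0 < volume Ω) :
    infRatio B ≤ ldRatio Ω := by
  refine csInf_le ⟨0, ?_⟩ ⟨Ω, hΩ, hB, h0, rfl⟩
  rintro r ⟨Ω, -, -, -, rfl⟩
  exact div_nonneg ldEnergy_nonneg ENNReal.toReal_nonneg

lemma IsDrop.ldRatio_mul (hΩ : IsDrop Ω) (h0 : 0 < volume Ω) :
    ldRatio Ω * volume.real Ω = ldEnergy Ω :=
  div_mul_cancel₀ _ (ENNReal.toReal_pos h0.ne' hΩ.volume_ne_top).ne'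

lemma infRatio_mul_le (hΩ : IsDrop Ω) (hB : Ω ⊆ B) :
    infRatio B * volume.real Ω ≤ ldEnergy Ω := by
  rcases eq_or_ne (volume Ω) 0 with h0 | h0
  · simpa [measureReal_def, h0] using ldEnergy_nonneg
  · rw [← hΩ.ldRatio_mul (pos_iff_ne_zero.2 h0)]
    exact mul_le_mul_of_nonneg_right (infRatio_le hΩ hB (pos_iff_ne_zero.2 h0)) measureReal_nonneg

lemma exists_ldRatio_lt (hS : IsDrop S) (hB : S ⊆ B) (h0 : 0 < volume S) {ε : ℝ} (hε : 0 < ε) :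
    ∃ Ω, IsDrop Ω ∧ Ω ⊆ B ∧ 0 < volume Ω ∧ ldRatio Ω < infRatio B + ε := by
  obtain ⟨r, ⟨Ω, h1, h2, h3, rfl⟩, hr⟩ := exists_lt_of_csInf_lt
    (s := {r | ∃ Ω, IsDrop Ω ∧ Ω ⊆ B ∧ 0 < volume Ω ∧ r = ldRatio Ω})
    ⟨_, S, hS, hB, h0, rfl⟩ (lt_add_of_pos_right (infRatio B) hε)
  exact ⟨Ω, h1, h2, h3, hr⟩

lemma exists_isDrop_volume_eq {A : ℝ} (hA : 0 < A) :
    ∃ Ω, IsDrop Ω ∧ volume Ω = ENNReal.ofReal A := by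
  obtain ⟨Ω, h1, h2, h3⟩ := exists_finitePerimeter_volume_eq (d := 3) hA
  exact ⟨Ω, ⟨h1, h2, h3 ▸ ENNReal.ofReal_ne_top⟩, h3⟩

/-- A competitor can be cut between two spheres at small cost. -/
lemma IsDrop.exists_split (hΩ : IsDrop Ω) {j : ℝ} (hj : 0 < j) :
    ∃ t ∈ Ioo j (2 * j), IsDrop (Ω ∩ {x | softNorm x < t}) ∧ IsDrop (Ω ∩ {x | t ≤ softNorm x}) ∧
      ldEnergy (Ω ∩ {x | softNorm x < t}) + ldEnergy (Ω ∩ {x | t ≤ softNorm x}) ≤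
        ldEnergy Ω + 4 * stepBound * (volume.real Ω / j) ∧
      volume.real Ω = volume.real (Ω ∩ {x | softNorm x < t}) +
        volume.real (Ω ∩ {x | t ≤ softNorm x}) := by
  obtain ⟨hm, hP, hv⟩ := hΩ
  obtain ⟨t, ht, hSP, hTP, hle⟩ := exists_cut hm hP hv contDiff_softNorm norm_fderiv_softNorm_le
    (show j < 2 * j by linarith)
  refine ⟨t, ht, ?_⟩
  set S := Ω ∩ {x : E3 | softNorm x < t}
  set T := Ω ∩ {x : E3 | t ≤ softNorm x}
  have hSm : MeasurableSet S := hm.inter (measurable_softNorm measurableSet_Iio)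
  have hTm : MeasurableSet T := hm.inter (measurable_softNorm measurableSet_Ici)
  have hSv : volume S ≠ ∞ := measure_ne_top_of_subset inter_subset_left hv
  have hTv : volume T ≠ ∞ := measure_ne_top_of_subset inter_subset_left hv
  have hST : Disjoint S T := disjoint_left.2 fun x hx hx' =>
    not_lt.2 (show t ≤ softNorm x from hx'.2) hx.2
  have hun : S ∪ T = Ω := by
    ext x
    simp only [S, T, mem_union, mem_inter_iff, mem_ofPred_eq, ← and_or_left]
    simp [lt_or_ge]
  have h1 := coulomb_union hSm hTm hSv hTv hST
  have h2 := measureReal_union hST hTm hSv hTv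
  rw [hun] at h1 h2
  refine ⟨⟨hSm, hSP, hSv⟩, ⟨hTm, hTP, hTv⟩, ?_, h2⟩
  have h3 := mutualCoulomb_nonneg (S := S) (T := T)
  rw [show 2 * j - j = j by ring] at hle
  simp only [ldEnergy]
  linarith

/-- Competitors can be truncated with little effect on the ratio. -/
lemma IsDrop.exists_truncation (hΩ : IsDrop Ω) (h0 : 0 < volume Ω) {ε : ℝ} (hε : 0 < ε) :
    ∃ R, 0 < R ∧ ∃ S, IsDrop S ∧ S ⊆ ball 0 R ∧ 0 < volume S ∧ ldRatio S < ldRatio Ω + ε := by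
  have hv : 0 < volume.real Ω := ENNReal.toReal_pos h0.ne' hΩ.volume_ne_top
  have hlim : Tendsto (fun j : ℕ => volume.real (Ω ∩ {x : E3 | softNorm x < j})) atTop
      (𝓝 (volume.real Ω)) := by
    have h1 : Monotone fun j : ℕ => Ω ∩ {x : E3 | softNorm x < j} := fun i j hij x hx =>
      ⟨hx.1, (show softNorm x < i from hx.2).trans_le (Nat.cast_le.2 hij)⟩
    have h2 := tendsto_measure_iUnion_atTop (μ := volume) h1
    have h3 : ⋃ j : ℕ, Ω ∩ {x : E3 | softNorm x < j} = Ω := by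
      rw [← inter_iUnion, inter_eq_left]
      intro x _
      obtain ⟨j, hj⟩ := exists_nat_gt (softNorm x)
      exact mem_iUnion.2 ⟨j, hj⟩
    rw [h3] at h2
    exact (ENNReal.tendsto_toReal hΩ.volume_ne_top).comp h2
  have hnum : Tendsto (fun j : ℕ => ldEnergy Ω + 4 * stepBound * (volume.real Ω / (j:ℝ))) atTop
      (𝓝 (ldEnergy Ω)) := by
    simpa using ((tendsto_const_div_atTop_nhds_zero_nat (volume.real Ω)).const_mul
      (4 * stepBound)).const_add (ldEnergy Ω)
  have hq := (hnum.div hlim hv.ne').eventually_lt_const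
    (show ldEnergy Ω / volume.real Ω < ldRatio Ω + ε from lt_add_of_pos_right _ hε)
  obtain ⟨j, hj1, hj2, hj3⟩ :=
    (hq.and ((hlim.eventually_const_lt hv).and (eventually_gt_atTop 0))).exists
  have hj0 : (0:ℝ) < j := Nat.cast_pos.2 hj3
  obtain ⟨t, ht, hS, -, hle, -⟩ := hΩ.exists_split hj0
  have hmono : volume.real (Ω ∩ {x : E3 | softNorm x < j}) ≤
      volume.real (Ω ∩ {x : E3 | softNorm x < t}) :=
    measureReal_mono (fun x hx => ⟨hx.1, lt_trans hx.2 ht.1⟩) hS.volume_ne_top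
  refine ⟨t, hj0.trans ht.1, _, hS, inter_subset_right.trans (setOf_softNorm_lt_subset_ball t),
    ?_, lt_of_le_of_lt ?_ hj1⟩
  · exact (ENNReal.toReal_pos_iff.1 (hj2.trans_le hmono)).1
  · have h5 := ldEnergy_nonneg (Ω := Ω ∩ {x | t ≤ softNorm x})
    have h6 := ldEnergy_nonneg (Ω := Ω ∩ {x | softNorm x < t})
    exact div_le_div₀ (by linarith) (by linarith) hj2 hmono

/-- A competitor nearly minimizing the energy per volume, no subset of which has smaller energy
per volume than `μ`. -/
structure IsNearMin (ε μ : ℝ) (Ω : Set E3) : Prop extends IsDrop Ω where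
  volume_pos : 0 < volume Ω
  volume_le : volume Ω ≤ ENNReal.ofReal (12 + 24 * stepBound)
  le_add : μ ≤ infRatio univ + ε
  mul_le : ∀ S ⊆ Ω, IsDrop S → μ * volume.real S ≤ ldEnergy S
  energy_le : ldEnergy Ω ≤ (μ + ε) * volume.real Ω

lemma exists_isNearMin {ε : ℝ} (hε : 0 < ε) : ∃ μ Ω, IsNearMin ε μ Ω := by
  obtain ⟨Ω₀, h1, h2⟩ := exists_isDrop_volume_eq one_pos
  obtain ⟨Ω₁, h3, -, h4, h5⟩ := exists_ldRatio_lt (B := univ) h1 (subset_univ _) (by simp [h2])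
    (half_pos hε)
  obtain ⟨R, hR, Ω₂, h6, h7, h8, h9⟩ := h3.exists_truncation h4 (half_pos hε)
  set R' := max R (1 / ε) with hR'
  have hR'0 : 0 < R' := hR.trans_le (le_max_left _ _)
  have h7' : Ω₂ ⊆ ball 0 R' := h7.trans (ball_subset_ball (le_max_left _ _))
  obtain ⟨Ω, g1, g2, g3, g4⟩ := exists_ldRatio_lt h6 h7' h8 (one_div_pos.2 hR'0)
  have hher : ∀ S ⊆ Ω, IsDrop S → infRatio (ball 0 R') * volume.real S ≤ ldEnergy S :=
    fun S hS hSd => infRatio_mul_le hSd (hS.trans g2)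
  have hle : ldEnergy Ω ≤ (infRatio (ball 0 R') + 1 / R') * volume.real Ω := by
    rw [← g1.ldRatio_mul g3]
    exact mul_le_mul_of_nonneg_right g4.le measureReal_nonneg
  have hRε : 1 / R' ≤ ε := by
    rw [one_div_le hR'0 hε]
    exact le_max_right _ _
  refine ⟨infRatio (ball 0 R'), Ω, g1, g3, g1.volume_le hR'0 g2 hher hle, ?_, hher, hle.trans ?_⟩
  · linarith [infRatio_le h6 h7' h8]
  · gcongr

lemma IsDrop.preimage_add_right (hΩ : IsDrop Ω) (a : E3) : IsDrop ((· + a) ⁻¹' Ω) where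
  measurableSet := measurable_add_const a hΩ.measurableSet
  finitePerimeter := by
    rw [FinitePerimeter, perSet_preimage_add_right]
    exact hΩ.finitePerimeter
  volume_ne_top := by
    rw [measure_preimage_add_right]
    exact hΩ.volume_ne_top

lemma volume_real_preimage_add_right (a : E3) :
    volume.real ((· + a) ⁻¹' Ω) = volume.real Ω := by
  rw [measureReal_def, measure_preimage_add_right, measureReal_def]

lemma ldEnergy_preimage_add_right (a : E3) : ldEnergy ((· + a) ⁻¹' Ω) = ldEnergy Ω := by
  rw [ldEnergy, ldEnergy, coulomb_preimage_add_right, perimeter, perimeter,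
    perSet_preimage_add_right]

lemma IsNearMin.preimage_add_right {ε μ : ℝ} (h : IsNearMin ε μ Ω) (a : E3) :
    IsNearMin ε μ ((· + a) ⁻¹' Ω) where
  toIsDrop := h.toIsDrop.preimage_add_right a
  volume_pos := by rw [measure_preimage_add_right]; exact h.volume_pos
  volume_le := by rw [measure_preimage_add_right]; exact h.volume_le
  le_add := h.le_add
  mul_le := fun S hS hSd => by
    rw [← volume_real_preimage_add_right (-a), ← ldEnergy_preimage_add_right (-a)]
    refine h.mul_le _ (fun x hx => ?_) (hSd.preimage_add_right _)
    simpa using hS hx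
  energy_le := by
    rw [ldEnergy_preimage_add_right, volume_real_preimage_add_right]
    exact h.energy_le

lemma exists_isNearMin_inter_ball {ε : ℝ} (hε : 0 < ε) (hε1 : ε ≤ 1) {ρ : ℝ}
    (hρ : ρ = 1 / (4 * (infRatio univ + 2))) :
    ∃ μ Ω, IsNearMin ε μ Ω ∧ volume (ball (0 : E3) ρ) / 2 ≤ volume (Ω ∩ ball 0 ρ) := by
  obtain ⟨μ, Ω, h⟩ := exists_isNearMin hε
  have hm : 0 ≤ infRatio univ := infRatio_nonneg
  have hρ0 : 0 < ρ := by rw [hρ]; positivity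
  have hv : 0 < volume.real Ω := ENNReal.toReal_pos h.volume_pos.ne' h.volume_ne_top
  have hP : perimeter 3 Ω ≤ (infRatio univ + 2) * volume.real Ω := by
    have h1 := h.energy_le
    have h2 := coulomb_nonneg (S := Ω)
    have h3 : (μ + ε) * volume.real Ω ≤ (infRatio univ + 2) * volume.real Ω := by
      have := h.le_add
      exact mul_le_mul_of_nonneg_right (by linarith) hv.le
    rw [ldEnergy] at h1
    linarith
  have hlt : ρ * perimeter 3 Ω < volume.real Ω / 2 := by
    calc ρ * perimeter 3 Ω ≤ ρ * ((infRatio univ + 2) * volume.real Ω) := by gcongr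
      _ = volume.real Ω / 4 := by rw [hρ]; field_simp
      _ < _ := by linarith
  obtain ⟨a, ha⟩ := h.finitePerimeter.exists_le_volume_inter_ball h.measurableSet
    h.volume_ne_top hρ0 hlt
  refine ⟨μ, _, h.preimage_add_right a, ha.trans_eq ?_⟩
  rw [← measure_preimage_add_right volume a (Ω ∩ ball a ρ), preimage_inter]
  congr 2
  ext x
  simp

end NearMinimizers

section Existence

/-- Some competitor of positive volume minimizes the energy per volume. -/
lemma exists_ldEnergy_le_infRatio_mul :
    ∃ F, IsDrop F ∧ 0 < volume F ∧ ldEnergy F ≤ infRatio univ * volume.real F := by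
  set m := infRatio univ with hm
  have hm0 : 0 ≤ m := infRatio_nonneg
  set C : ℝ := 12 + 24 * stepBound with hC
  have hK := stepBound_nonneg
  have hC0 : 0 ≤ C := by positivity
  set ρ : ℝ := 1 / (4 * (m + 2)) with hρ
  have hρ0 : 0 < ρ := by positivity
  choose μ E hE hEρ using fun k : ℕ => exists_isNearMin_inter_ball
    (Nat.one_div_pos_of_nat (α := ℝ) (n := k)) ((div_le_one (by positivity)).2 (by simp)) hρ
  have hECr : ∀ k, volume.real (E k) ≤ C := fun k =>
    ENNReal.toReal_le_of_le_ofReal hC0 (hE k).volume_le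
  have hEP : ∀ k, perimeter 3 (E k) ≤ (m + 2) * C := fun k => by
    have h1 := (hE k).energy_le
    have h2 := coulomb_nonneg (S := E k)
    have h3 := (hE k).le_add
    have h4 : 1 / ((k:ℝ) + 1) ≤ 1 := (div_le_one (by positivity)).2 (by simp)
    have h5 : (μ k + 1 / ((k:ℝ) + 1)) * volume.real (E k) ≤ (m + 2) * C :=
      mul_le_mul (by linarith) (hECr k) measureReal_nonneg (by linarith)
    rw [ldEnergy] at h1
    linarith
  have hEm : ∀ k, MeasurableSet (E k) := fun k => (hE k).measurableSet
  obtain ⟨F, hF, φ, hφ, hlim⟩ := exists_subseq_tendsto_indicator hEm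
    (fun k => (hE k).volume_ne_top) (fun k => (hE k).finitePerimeter) hEP
  have hvol : ∀ B : Set E3, MeasurableSet B → volume B ≠ ∞ →
      Tendsto (fun n => volume.real (E (φ n) ∩ B)) atTop (𝓝 (volume.real (F ∩ B))) :=
    fun B hB hBv => by
      have h1 := tendsto_setIntegral_of_tendsto_indicator (fun n => hEm (φ n)) hF hlim
        ((integrable_indicator_iff hB).2 (integrableOn_const (C := (1:ℝ)) hBv))
      simpa [setIntegral_indicator hB] using h1
  have hFv : volume F ≠ ∞ := by
    refine ((measure_le_liminf_of_tendsto_indicator (fun n => hEm (φ n)) hF hlim).trans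
      (liminf_le_of_le (by isBoundedDefault) fun b hb => ?_)).trans_lt
      (ENNReal.ofReal_lt_top (r := C)) |>.ne
    obtain ⟨n, hn⟩ := hb.exists
    exact hn.trans (hE _).volume_le
  have hF0 : 0 < volume F := by
    have hb : 0 < volume.real (ball (0 : E3) ρ) :=
      ENNReal.toReal_pos (measure_ball_pos _ _ hρ0).ne' measure_ball_lt_top.ne
    have h1 : volume.real (ball (0 : E3) ρ) / 2 ≤ volume.real (F ∩ ball 0 ρ) :=
      ge_of_tendsto' (hvol _ measurableSet_ball measure_ball_lt_top.ne) fun n => by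
        have := ENNReal.toReal_mono
          (measure_ne_top_of_subset inter_subset_left (hE (φ n)).volume_ne_top) (hEρ (φ n))
        rwa [ENNReal.toReal_div] at this
    have h2 : 0 < volume.real (F ∩ ball 0 ρ) := by linarith
    exact (ENNReal.toReal_pos_iff.1 h2).1.trans_le (measure_mono inter_subset_left)
  have hchoose : ∀ j : ℕ, ∃ n, j ≤ n ∧
      volume.real (E (φ n) ∩ {x | softNorm x < 2 * ((j:ℝ) + 1)}) ≤
        volume.real F + 1 / ((j:ℝ) + 1) := fun j => by
    have hlt : volume.real (F ∩ {x | softNorm x < 2 * ((j:ℝ) + 1)}) <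
        volume.real F + 1 / ((j:ℝ) + 1) :=
      lt_of_le_of_lt (measureReal_mono inter_subset_left hFv)
        (lt_add_of_pos_right _ (by positivity))
    obtain ⟨n, h1, h2⟩ := (((hvol _ (measurable_softNorm measurableSet_Iio)
      ((measure_mono (setOf_softNorm_lt_subset_ball _)).trans_lt
        measure_ball_lt_top).ne).eventually_lt_const hlt).and (eventually_ge_atTop j)).exists
    exact ⟨n, h2, h1.le⟩
  choose n hn hnv using hchoose
  have hsplit := fun j : ℕ =>
    (hE (φ (n j))).toIsDrop.exists_split (show (0:ℝ) < (j:ℝ) + 1 by positivity)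
  choose t ht hS hT hle hadd using hsplit
  have hlim' : ∀ᵐ x, Tendsto (fun j => (E (φ (n j)) ∩ {x | softNorm x < t j}).indicator
      (fun _ => (1:ℝ)) x) atTop (𝓝 (F.indicator (fun _ => (1:ℝ)) x)) := by
    filter_upwards [hlim] with x hx
    refine (hx.comp (tendsto_atTop_mono hn tendsto_id)).congr' ?_
    obtain ⟨N, hN⟩ := exists_nat_gt (softNorm x)
    filter_upwards [eventually_ge_atTop N] with j hj
    have h1 : softNorm x < t j := by
      have := (ht j).1
      have : (N:ℝ) ≤ j := Nat.cast_le.2 hj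
      linarith
    have h2 : (x ∈ E (φ (n j)) ∩ {x | softNorm x < t j}) ↔ x ∈ E (φ (n j)) :=
      ⟨fun h => h.1, fun h => ⟨h, h1⟩⟩
    change (E (φ (n j))).indicator (fun _ => (1:ℝ)) x = _
    by_cases hxE : x ∈ E (φ (n j))
    · rw [indicator_of_mem hxE, indicator_of_mem (h2.2 hxE)]
    · rw [indicator_of_notMem hxE, indicator_of_notMem (mt h2.1 hxE)]
  have hbound : ∀ j : ℕ, ldEnergy (E (φ (n j)) ∩ {x | softNorm x < t j}) ≤
      (m + 1 / ((j:ℝ) + 1)) * (volume.real F + 1 / ((j:ℝ) + 1)) +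
        (C + 4 * stepBound * C) * (1 / ((j:ℝ) + 1)) := fun j => by
    set S := E (φ (n j)) ∩ {x | softNorm x < t j} with hSdef
    set T := E (φ (n j)) ∩ {x | t j ≤ softNorm x} with hTdef
    set η : ℝ := 1 / ((j:ℝ) + 1) with hη
    have hη0 : 0 < η := by positivity
    have hε : 1 / ((φ (n j) : ℝ) + 1) ≤ η :=
      Nat.one_div_le_one_div ((hn j).trans (hφ.id_le (n j)))
    have hnear := hE (φ (n j))
    have h1 := hnear.mul_le T inter_subset_left (hT j)
    have h2 := hnear.energy_le
    have h3 := hnear.le_add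
    have h4 := hle j
    have h5 := hadd j
    have h6 := hECr (φ (n j))
    have h7 : volume.real S ≤ volume.real F + η := by
      have hsub : S ⊆ E (φ (n j)) ∩ {x | softNorm x < 2 * ((j:ℝ) + 1)} := fun x hx =>
        ⟨hx.1, (show softNorm x < t j from hx.2).trans (ht j).2⟩
      exact (measureReal_mono hsub
        (measure_ne_top_of_subset inter_subset_left hnear.volume_ne_top)).trans (hnv j)
    have h8 : μ (φ (n j)) * volume.real S ≤ (m + η) * (volume.real F + η) :=
      mul_le_mul (by linarith) h7 measureReal_nonneg (by linarith)
    have h9 : 1 / ((φ (n j) : ℝ) + 1) * volume.real (E (φ (n j))) ≤ η * C :=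
      mul_le_mul hε h6 measureReal_nonneg hη0.le
    have h10 : 4 * stepBound * (volume.real (E (φ (n j))) / ((j:ℝ) + 1)) ≤
        4 * stepBound * C * η := by
      rw [div_eq_mul_one_div, ← hη, mul_assoc (4 * stepBound)]
      gcongr
    have h11 : μ (φ (n j)) * volume.real (E (φ (n j))) =
        μ (φ (n j)) * volume.real S + μ (φ (n j)) * volume.real T := by rw [h5, mul_add]
    rw [add_mul, h11] at h2
    linarith
  have hlimc : Tendsto (fun j : ℕ => (m + 1 / ((j:ℝ) + 1)) * (volume.real F + 1 / ((j:ℝ) + 1)) +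
        (C + 4 * stepBound * C) * (1 / ((j:ℝ) + 1))) atTop (𝓝 (m * volume.real F)) := by
    have h := tendsto_one_div_add_atTop_nhds_zero_nat (𝕜 := ℝ)
    simpa using ((h.const_add m).mul (h.const_add (volume.real F))).add
      (h.const_mul (C + 4 * stepBound * C))
  obtain ⟨h1, h2⟩ := ldEnergy_le_of_tendsto (fun j => (hS j).measurableSet)
    (fun j => (hS j).volume_ne_top) (fun j => (hS j).finitePerimeter) hF hFv hlim' hbound hlimc
  exact ⟨F, ⟨hF, h1, hFv⟩, hF0, h2⟩

lemma infRatio_univ_mul_le_ldE {A : ℝ} (hA : 0 < A) : infRatio univ * A ≤ ldE A := by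
  obtain ⟨Ω, h1, h2⟩ := exists_isDrop_volume_eq hA
  refine le_csInf ⟨_, Ω, h1.measurableSet, h1.finitePerimeter, h2, rfl⟩ ?_
  rintro e ⟨Ω, hm, hP, hv, rfl⟩
  have := infRatio_mul_le ⟨hm, hP, hv ▸ ENNReal.ofReal_ne_top⟩ (subset_univ Ω)
  rwa [measureReal_def, hv, ENNReal.toReal_ofReal hA.le] at this

end Existence

/-- existence of a global minimizer of the binding energy per particle. -/
theorem iron :
    ∃ Astar : ℝ, 0 < Astar ∧ (∀ A : ℝ, 0 < A → ldE Astar / Astar ≤ ldE A / A) ∧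
      ∃ Ωstar : Set E3, MeasurableSet Ωstar ∧ FinitePerimeter 3 Ωstar ∧
        volume Ωstar = ENNReal.ofReal Astar ∧ ldEnergy Ωstar = ldE Astar ∧
        ∀ Ω : Set E3, MeasurableSet Ω → FinitePerimeter 3 Ω →
          0 < volume Ω → volume Ω < ⊤ → ldRatio Ωstar ≤ ldRatio Ω := by
  obtain ⟨F, hF, hF0, hle⟩ := exists_ldEnergy_le_infRatio_mul
  have hA : 0 < volume.real F := ENNReal.toReal_pos hF0.ne' hF.volume_ne_top
  have hvol : volume F = ENNReal.ofReal (volume.real F) :=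
    (ofReal_measureReal hF.volume_ne_top).symm
  have hldE : ldE (volume.real F) ≤ ldEnergy F := by
    refine csInf_le ⟨0, ?_⟩ ⟨F, hF.measurableSet, hF.finitePerimeter, hvol, rfl⟩
    rintro e ⟨Ω, -, -, -, rfl⟩
    exact ldEnergy_nonneg
  refine ⟨volume.real F, hA, fun A hA' => ?_, F, hF.measurableSet, hF.finitePerimeter, hvol,
    (hle.trans (infRatio_univ_mul_le_ldE hA)).antisymm hldE, fun Ω hm hP h0 ht => ?_⟩
  · calc ldE (volume.real F) / volume.real F ≤ infRatio univ :=
          (div_le_iff₀ hA).2 (hldE.trans hle)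
      _ ≤ ldE A / A := (le_div_iff₀ hA').2 (infRatio_univ_mul_le_ldE hA')
  · exact ((div_le_iff₀ hA).2 hle).trans (infRatio_le ⟨hm, hP, ht.ne⟩ (subset_univ Ω) h0)
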